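/- arXiv:1603.07280 — 2 statements merged into one kernel-verified Lean document; each statement's English description precedes it below -/
import Mathlib

section
/- There exists a finite extremal parameter λ* > 0 such that: for every λ ∈ (0, λ*) the radial problem (P_λ) admits a classical radial solution, and for every λ > λ* the problem (P_λ) admits no classical radial solution. (Equivalently, λ* = sup{λ > 0 : (P_λ) has a classical radial solution} satisfies 0 < λ* < ∞.) -/
open Real Set Filter MeasureTheory

noncomputable section

/-- `c_{n,k} = (1/n) * binom(n,k)`. -/
def cnk (n k : ℕ) : ℝ := (n.choose k : ℝ) / n

/-- The critical exponent `q*(k,σ) = ((n+2)k + σ(k+1))/(n-2k)`. -/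
def qstar (n k : ℕ) (σ : ℝ) : ℝ :=
  (((n : ℝ) + 2) * k + σ * ((k : ℝ) + 1)) / ((n : ℝ) - 2 * k)

/-- The Joseph–Lundgren type exponent `q_JL(k,σ)` (finite formula, valid
for `n > 2k + 8 + 4σ/k`). -/
def qJL (n k : ℕ) (σ : ℝ) : ℝ :=
  (k : ℝ) *
    (((k : ℝ) * ((k : ℝ) + 1) * n - (k : ℝ) ^ 2 * (2 - σ) + 2 * k + σ -
        2 * Real.sqrt ((k : ℝ) * (2 * k + σ) * (((k : ℝ) + 1) * n - (k : ℝ) * (2 - σ)))) /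
      ((k : ℝ) * ((k : ℝ) + 1) * n - 2 * (k : ℝ) ^ 2 * ((k : ℝ) + 3) - 2 * k * σ -
        2 * Real.sqrt ((k : ℝ) * (2 * k + σ) * (((k : ℝ) + 1) * n - (k : ℝ) * (2 - σ)))))

/-- `λ̃(k,σ) = c_{n,k} τ_σ^k (n - 2k - k τ_σ)` with `τ_σ = (2k+σ)/(q-k)`. -/
def lamTilde (n k : ℕ) (q σ : ℝ) : ℝ :=
  cnk n k * ((2 * (k : ℝ) + σ) / (q - k)) ^ k *
    ((n : ℝ) - 2 * k - (k : ℝ) * ((2 * (k : ℝ) + σ) / (q - k)))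

/-- `μ*(k,σ) = binom(n,k) ((n+σ)/n) (n-2k)^k / (k+1)^{k+1}`. -/
def muStar (n k : ℕ) (σ : ℝ) : ℝ :=
  (n.choose k : ℝ) * (((n : ℝ) + σ) / n) * ((n : ℝ) - 2 * k) ^ k / ((k : ℝ) + 1) ^ (k + 1)

/-- A classical radial solution of problem `(P_λ)`:
`u ∈ C²((0,1)) ∩ C¹([0,1])`, `u'(0) = 0`, `u(1) = 0`, `u < 0` on `(0,1)`,
`(r^{n-i} (u')^i)' ≥ 0` on `(0,1)` for `i = 1,…,k`, and
`c_{n,k} r^{1-n} (r^{n-k}(u')^k)' = λ r^σ (1-u)^q` on `(0,1)`. -/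
def IsRadialSol (n k : ℕ) (q σ lam : ℝ) (u : ℝ → ℝ) : Prop :=
  ContDiffOn ℝ 2 u (Ioo 0 1) ∧ ContDiffOn ℝ 1 u (Icc 0 1) ∧
  deriv u 0 = 0 ∧ u 1 = 0 ∧
  (∀ r ∈ Ioo (0:ℝ) 1, u r < 0) ∧
  (∀ i : ℕ, 1 ≤ i → i ≤ k →
    ∀ r ∈ Ioo (0:ℝ) 1, 0 ≤ deriv (fun s => s ^ ((n : ℝ) - i) * (deriv u s) ^ i) r) ∧
  (∀ r ∈ Ioo (0:ℝ) 1,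
    cnk n k * r ^ (1 - (n : ℝ)) *
        deriv (fun s => s ^ ((n : ℝ) - k) * (deriv u s) ^ k) r =
      lam * r ^ σ * (1 - u r) ^ q)

/-- A radial subsolution of `(P_λ)`. -/
def IsRadialSubsol (n k : ℕ) (q σ lam : ℝ) (u : ℝ → ℝ) : Prop :=
  ContDiffOn ℝ 2 u (Ioo 0 1) ∧ ContDiffOn ℝ 1 u (Icc 0 1) ∧
  (∀ i : ℕ, 1 ≤ i → i ≤ k →
    ∀ r ∈ Ioo (0:ℝ) 1, 0 ≤ deriv (fun s => s ^ ((n : ℝ) - i) * (deriv u s) ^ i) r) ∧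
  (∀ r ∈ Ioo (0:ℝ) 1,
    lam * r ^ σ * (1 - u r) ^ q ≤
      cnk n k * r ^ (1 - (n : ℝ)) *
        deriv (fun s => s ^ ((n : ℝ) - k) * (deriv u s) ^ k) r) ∧
  u 1 ≤ 0

/-- clamp to the unit interval -/
def clp (s : ℝ) : ℝ := max 0 (min s 1)

lemma clp_mem (s : ℝ) : clp s ∈ Icc (0:ℝ) 1 :=
  ⟨le_max_left _ _, max_le zero_le_one (min_le_right _ _)⟩

lemma clp_of_mem {s : ℝ} (hs : s ∈ Icc (0:ℝ) 1) : clp s = s := by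
  unfold clp; rw [min_eq_left hs.2, max_eq_right hs.1]

lemma clp_cont : Continuous clp := by unfold clp; fun_prop

/-- weight integrand -/
def fI (n : ℕ) (q σ : ℝ) (v : ℝ → ℝ) (t : ℝ) : ℝ := t ^ ((n:ℝ) - 1 + σ) * (1 + v t) ^ q

/-- its primitive -/
def GI (n : ℕ) (q σ : ℝ) (v : ℝ → ℝ) (s : ℝ) : ℝ := ∫ t in (0:ℝ)..s, fI n q σ v t

/-- the slope formula -/
def HI (n k : ℕ) (q σ L : ℝ) (v : ℝ → ℝ) (s : ℝ) : ℝ :=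
  (L * s ^ ((k:ℝ) - n) * GI n q σ v s) ^ (1 / (k:ℝ))

/-- the integral operator -/
def TI (n k : ℕ) (q σ L : ℝ) (v : ℝ → ℝ) (r : ℝ) : ℝ :=
  ∫ s in r..1, HI n k q σ L v (clp s)

/-- admissible profile -/
def Adm (v : ℝ → ℝ) : Prop := AntitoneOn v (Icc 0 1) ∧ ∀ r ∈ Icc (0:ℝ) 1, 0 ≤ v r

section
variable {n k : ℕ} {q σ L : ℝ} {v w : ℝ → ℝ}

lemma fI_int (hn : 1 ≤ n) (hq : 0 < q) (hσ : 0 ≤ σ) (hv : Adm v) :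
    IntervalIntegrable (fI n q σ v) volume 0 1 := by
  have hn' : (1:ℝ) ≤ n := by exact_mod_cast hn
  have h1 : AntitoneOn (fun t => (1 + v t) ^ q) (Icc 0 1) := by
    intro a ha b hb hab
    have := hv.1 ha hb hab
    have h2 := hv.2 b hb
    exact Real.rpow_le_rpow (by linarith) (by linarith) hq.le
  have h2 : IntervalIntegrable (fun t => (1 + v t) ^ q) volume 0 1 := by
    apply AntitoneOn.intervalIntegrable
    rwa [uIcc_of_le zero_le_one]
  apply IntervalIntegrable.continuousOn_mul h2
  intro t _
  exact (Real.continuous_rpow_const (by linarith)).continuousWithinAt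

lemma fI_int' (hn : 1 ≤ n) (hq : 0 < q) (hσ : 0 ≤ σ) (hv : Adm v) {s : ℝ} (hs : s ∈ Icc (0:ℝ) 1) :
    IntervalIntegrable (fI n q σ v) volume 0 s := by
  apply (fI_int hn hq hσ hv).mono_set
  rw [uIcc_of_le zero_le_one, uIcc_of_le hs.1]
  exact Icc_subset_Icc le_rfl hs.2

lemma fI_nonneg (hv : Adm v) {t : ℝ} (ht : t ∈ Icc (0:ℝ) 1) : 0 ≤ fI n q σ v t := by
  have := hv.2 t ht
  exact mul_nonneg (Real.rpow_nonneg ht.1 _) (Real.rpow_nonneg (by linarith) _)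

lemma fI_pos (hv : Adm v) {t : ℝ} (ht : t ∈ Ioc (0:ℝ) 1) : 0 < fI n q σ v t := by
  have := hv.2 t ⟨ht.1.le, ht.2⟩
  exact mul_pos (Real.rpow_pos_of_pos ht.1 _) (Real.rpow_pos_of_pos (by linarith) _)

lemma GI_nonneg (hv : Adm v) {s : ℝ} (hs : s ∈ Icc (0:ℝ) 1) : 0 ≤ GI n q σ v s := by
  apply intervalIntegral.integral_nonneg hs.1
  intro t ht
  exact fI_nonneg hv ⟨ht.1, ht.2.trans hs.2⟩

lemma GI_pos (hn : 1 ≤ n) (hq : 0 < q) (hσ : 0 ≤ σ) (hv : Adm v) {s : ℝ} (hs : s ∈ Ioc (0:ℝ) 1) :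
    0 < GI n q σ v s := by
  apply intervalIntegral.intervalIntegral_pos_of_pos_on
    (fI_int' hn hq hσ hv ⟨hs.1.le, hs.2⟩) _ hs.1
  intro t ht
  exact fI_pos hv ⟨ht.1, ht.2.le.trans hs.2⟩

lemma GI_le (hn : 1 ≤ n) (hq : 0 < q) (hσ : 0 ≤ σ) (hv : Adm v) {s : ℝ} (hs : s ∈ Icc (0:ℝ) 1) :
    GI n q σ v s ≤ (1 + v 0) ^ q * s ^ n := by
  have hn' : (1:ℝ) ≤ n := by exact_mod_cast hn
  have h0 := hv.2 0 (by simp)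
  have : GI n q σ v s ≤ ∫ t in (0:ℝ)..s, s ^ (n - 1) * (1 + v 0) ^ q := by
    apply intervalIntegral.integral_mono_on hs.1 (fI_int' hn hq hσ hv hs) (by simp)
    intro t ht
    have ht1 : t ∈ Icc (0:ℝ) 1 := ⟨ht.1, ht.2.trans hs.2⟩
    have h1 := hv.2 t ht1
    have h2 := hv.1 (by simp) ht1 ht.1
    apply mul_le_mul _ (Real.rpow_le_rpow (by linarith) (by linarith) hq.le)
      (Real.rpow_nonneg (by linarith) _) (pow_nonneg hs.1 _)
    calc t ^ ((n:ℝ) - 1 + σ) ≤ s ^ ((n:ℝ) - 1 + σ) := Real.rpow_le_rpow ht.1 ht.2 (by linarith)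
      _ ≤ s ^ ((n:ℝ) - 1) := by
        rcases hs.1.eq_or_lt with h | h
        · subst h
          rcases hn'.eq_or_lt with h3 | h3
          · rw [← h3]; norm_num
            exact Real.rpow_le_one le_rfl zero_le_one hσ
          · rw [Real.zero_rpow (by linarith), Real.zero_rpow (by linarith)]
        · exact Real.rpow_le_rpow_of_exponent_ge h hs.2 (by linarith)
      _ = s ^ (n - 1) := by
        rw [← Real.rpow_natCast]; push_cast [hn]; rfl
  refine this.trans (le_of_eq ?_)
  rw [intervalIntegral.integral_const, smul_eq_mul]
  obtain ⟨m, rfl⟩ : ∃ m, n = m + 1 := ⟨n - 1, by omega⟩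
  simp [pow_succ]; ring

lemma GI_mono (hn : 1 ≤ n) (hq : 0 < q) (hσ : 0 ≤ σ) (hv : Adm v) (hw : Adm w)
    (h : ∀ r ∈ Icc (0:ℝ) 1, v r ≤ w r) {s : ℝ} (hs : s ∈ Icc (0:ℝ) 1) :
    GI n q σ v s ≤ GI n q σ w s := by
  apply intervalIntegral.integral_mono_on hs.1 (fI_int' hn hq hσ hv hs) (fI_int' hn hq hσ hw hs)
  intro t ht
  have ht1 : t ∈ Icc (0:ℝ) 1 := ⟨ht.1, ht.2.trans hs.2⟩
  have h1 := hv.2 t ht1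
  have h2 := h t ht1
  exact mul_le_mul_of_nonneg_left (Real.rpow_le_rpow (by linarith) (by linarith) hq.le)
    (Real.rpow_nonneg ht.1 _)

lemma GI_cont (hn : 1 ≤ n) (hq : 0 < q) (hσ : 0 ≤ σ) (hv : Adm v) :
    ContinuousOn (GI n q σ v) (Icc 0 1) := by
  have := intervalIntegral.continuousOn_primitive_interval' (fI_int hn hq hσ hv)
    (a := 0) (by simp)
  rwa [uIcc_of_le zero_le_one] at this

lemma HI_nonneg (hL : 0 ≤ L) (hv : Adm v) {s : ℝ} (hs : s ∈ Icc (0:ℝ) 1) :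
    0 ≤ HI n k q σ L v s :=
  Real.rpow_nonneg (mul_nonneg (mul_nonneg hL (Real.rpow_nonneg hs.1 _)) (GI_nonneg hv hs)) _

lemma HI_pos (hn : 1 ≤ n) (hq : 0 < q) (hσ : 0 ≤ σ) (hL : 0 < L) (hv : Adm v) {s : ℝ}
    (hs : s ∈ Ioc (0:ℝ) 1) :
    0 < HI n k q σ L v s :=
  Real.rpow_pos_of_pos (mul_pos (mul_pos hL (Real.rpow_pos_of_pos hs.1 _))
    (GI_pos hn hq hσ hv hs)) _

lemma HI_zero (hk : 1 ≤ k) : HI n k q σ L v 0 = 0 := by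
  unfold HI GI
  rw [intervalIntegral.integral_same, mul_zero, Real.zero_rpow]
  have : (0:ℝ) < k := by exact_mod_cast hk
  positivity

lemma HI_mono {L' : ℝ} (hn : 1 ≤ n) (hq : 0 < q) (hσ : 0 ≤ σ) (hL : 0 ≤ L) (hLL : L ≤ L')
    (hv : Adm v) (hw : Adm w)
    (h : ∀ r ∈ Icc (0:ℝ) 1, v r ≤ w r) {s : ℝ} (hs : s ∈ Icc (0:ℝ) 1) :
    HI n k q σ L v s ≤ HI n k q σ L' w s := by
  have h1 := GI_mono (n := n) hn hq hσ hv hw h hs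
  have h0 := GI_nonneg (n := n) (q := q) (σ := σ) hv hs
  have h2 : 0 ≤ s ^ ((k:ℝ) - n) := Real.rpow_nonneg hs.1 _
  unfold HI
  apply Real.rpow_le_rpow (by positivity) _ (by positivity)
  have : 0 ≤ L' := hL.trans hLL
  gcongr

lemma HI_le (hk : 1 ≤ k) (hn : 1 ≤ n) (hq : 0 < q) (hσ : 0 ≤ σ) (hL : 0 ≤ L) (hv : Adm v) {s : ℝ}
    (hs : s ∈ Icc (0:ℝ) 1) :
    HI n k q σ L v s ≤ (L * (1 + v 0) ^ q) ^ (1 / (k:ℝ)) * s := by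
  have hk' : (0:ℝ) < k := by exact_mod_cast hk
  have hM : 0 ≤ (1 + v 0) ^ q := Real.rpow_nonneg (by linarith [hv.2 0 (by simp)]) _
  rcases hs.1.eq_or_lt with h | h
  · subst h; rw [HI_zero hk]; simp
  have h1 := GI_le (n := n) hn hq hσ hv hs
  have h0 := GI_nonneg (n := n) (q := q) (σ := σ) hv hs
  have h2 : 0 ≤ s ^ ((k:ℝ) - n) := Real.rpow_nonneg hs.1 _
  calc HI n k q σ L v s ≤ (L * s ^ ((k:ℝ) - n) * ((1 + v 0) ^ q * s ^ n)) ^ (1 / (k:ℝ)) := by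
        unfold HI
        apply Real.rpow_le_rpow (by positivity) _ (by positivity)
        gcongr
    _ = (L * (1 + v 0) ^ q * s ^ (k:ℝ)) ^ (1 / (k:ℝ)) := by
        congr 1
        have : s ^ (k:ℝ) = s ^ ((k:ℝ) - n) * s ^ n := by
          rw [← Real.rpow_natCast s n, ← Real.rpow_add h]; congr 1; ring
        rw [this]; ring
    _ = _ := by
        rw [Real.mul_rpow (by positivity) (Real.rpow_nonneg hs.1 _), ← Real.rpow_mul hs.1]
        congr 1
        rw [mul_one_div_cancel hk'.ne', Real.rpow_one]

lemma HI_cont (hk : 1 ≤ k) (hn : 1 ≤ n) (hq : 0 < q) (hσ : 0 ≤ σ) (hL : 0 ≤ L) (hv : Adm v) :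
    ContinuousOn (HI n k q σ L v) (Icc 0 1) := by
  intro s hs
  rcases hs.1.eq_or_lt with h | h
  · subst h
    unfold ContinuousWithinAt
    rw [HI_zero hk]
    apply squeeze_zero' (g := fun s => (L * (1 + v 0) ^ q) ^ (1 / (k:ℝ)) * s)
    · filter_upwards [self_mem_nhdsWithin] with t ht using HI_nonneg hL hv ht
    · filter_upwards [self_mem_nhdsWithin] with t ht using HI_le hk hn hq hσ hL hv ht
    · have : Continuous (fun s => (L * (1 + v 0) ^ q) ^ (1 / (k:ℝ)) * s) := by fun_prop
      have := this.tendsto 0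
      rw [mul_zero] at this
      exact this.mono_left nhdsWithin_le_nhds
  · unfold HI
    apply ContinuousWithinAt.rpow_const
    · apply ContinuousWithinAt.mul _ (GI_cont hn hq hσ hv s hs)
      apply ContinuousWithinAt.mul continuousWithinAt_const
      exact (Real.continuousAt_rpow_const s _ (Or.inl h.ne')).continuousWithinAt
    · right; positivity

lemma HIc_cont (hk : 1 ≤ k) (hn : 1 ≤ n) (hq : 0 < q) (hσ : 0 ≤ σ) (hL : 0 ≤ L) (hv : Adm v) :
    Continuous (fun s => HI n k q σ L v (clp s)) :=
  (HI_cont hk hn hq hσ hL hv).comp_continuous clp_cont clp_mem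

lemma TI_deriv (hk : 1 ≤ k) (hn : 1 ≤ n) (hq : 0 < q) (hσ : 0 ≤ σ) (hL : 0 ≤ L) (hv : Adm v)
    (r : ℝ) : HasDerivAt (fun r => - TI n k q σ L v r) (HI n k q σ L v (clp r)) r := by
  have hc := HIc_cont (k := k) hk hn hq hσ hL hv
  have := intervalIntegral.integral_hasDerivAt_right (hc.intervalIntegrable 1 r)
    (hc.stronglyMeasurableAtFilter _ _) hc.continuousAt
  have e : (fun r => - TI n k q σ L v r) = fun r => ∫ s in (1:ℝ)..r, HI n k q σ L v (clp s) := by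
    funext r
    unfold TI
    rw [intervalIntegral.integral_symm, neg_neg]
  rw [e]
  exact this

lemma TI_adm (hk : 1 ≤ k) (hn : 1 ≤ n) (hq : 0 < q) (hσ : 0 ≤ σ) (hL : 0 ≤ L) (hv : Adm v) :
    Adm (TI n k q σ L v) := by
  have hmono : Monotone (fun r => - TI n k q σ L v r) := by
    apply monotone_of_deriv_nonneg
    · intro r; exact (TI_deriv hk hn hq hσ hL hv r).differentiableAt
    · intro r; rw [(TI_deriv hk hn hq hσ hL hv r).deriv]
      exact HI_nonneg hL hv (clp_mem r)
  have ha : AntitoneOn (TI n k q σ L v) (Icc 0 1) := by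
    intro a _ b _ hab
    have := hmono hab
    simp only at this
    linarith
  refine ⟨ha, fun r hr => ?_⟩
  have := ha hr (by simp) hr.2
  have h1 : TI n k q σ L v 1 = 0 := intervalIntegral.integral_same
  linarith

lemma TI_mono {L' : ℝ} (hk : 1 ≤ k) (hn : 1 ≤ n) (hq : 0 < q) (hσ : 0 ≤ σ) (hL : 0 ≤ L)
    (hLL : L ≤ L') (hv : Adm v) (hw : Adm w)
    (h : ∀ r ∈ Icc (0:ℝ) 1, v r ≤ w r) {r : ℝ} (hr : r ∈ Icc (0:ℝ) 1) :
    TI n k q σ L v r ≤ TI n k q σ L' w r := by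
  apply intervalIntegral.integral_mono_on hr.2
    ((HIc_cont hk hn hq hσ hL hv).intervalIntegrable _ _)
    ((HIc_cont hk hn hq hσ (hL.trans hLL) hw).intervalIntegrable _ _)
  intro t _
  exact HI_mono hn hq hσ hL hLL hv hw h (clp_mem t)

/-- Knaster--Tarski. -/
lemma fixpoint (hk : 1 ≤ k) (hn : 1 ≤ n) (hq : 0 < q) (hσ : 0 ≤ σ) (hL : 0 ≤ L) (hv : Adm v)
    (hs : ∀ r ∈ Icc (0:ℝ) 1, TI n k q σ L v r ≤ v r) :
    ∃ w, Adm w ∧ ∀ r ∈ Icc (0:ℝ) 1, w r = TI n k q σ L w r := by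
  let S : Set (ℝ → ℝ) := {v | Adm v ∧ ∀ r ∈ Icc (0:ℝ) 1, TI n k q σ L v r ≤ v r}
  have hne : ∀ r, ((fun v : ℝ → ℝ => v r) '' S).Nonempty := fun r => ⟨v r, v, ⟨hv, hs⟩, rfl⟩
  have hbd : ∀ r ∈ Icc (0:ℝ) 1, BddBelow ((fun v : ℝ → ℝ => v r) '' S) := by
    intro r hr
    refine ⟨0, ?_⟩
    rintro _ ⟨x, hx, rfl⟩
    exact hx.1.2 r hr
  let w : ℝ → ℝ := fun r => sInf ((fun v : ℝ → ℝ => v r) '' S)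
  have hwle : ∀ x ∈ S, ∀ r ∈ Icc (0:ℝ) 1, w r ≤ x r := fun x hx r hr =>
    csInf_le (hbd r hr) ⟨x, hx, rfl⟩
  have hlew : ∀ (a r : ℝ), (∀ x ∈ S, a ≤ x r) → a ≤ w r := by
    intro a r h
    apply le_csInf (hne r)
    rintro _ ⟨x, hx, rfl⟩
    exact h x hx
  have hwa : Adm w := by
    constructor
    · intro a ha b hb hab
      apply hlew
      intro x hx
      exact (hwle x hx b hb).trans (hx.1.1 ha hb hab)
    · intro r hr
      exact hlew _ _ fun x hx => hx.1.2 r hr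
  have hTw : ∀ r ∈ Icc (0:ℝ) 1, TI n k q σ L w r ≤ w r := by
    intro r hr
    apply hlew
    intro x hx
    exact (TI_mono hk hn hq hσ hL le_rfl hwa hx.1 (hwle x hx) hr).trans (hx.2 r hr)
  have hTa := TI_adm (k := k) hk hn hq hσ hL hwa
  refine ⟨w, hwa, fun r hr => le_antisymm ?_ (hTw r hr)⟩
  exact hwle _ ⟨hTa, fun r hr => TI_mono hk hn hq hσ hL le_rfl hTa hwa hTw hr⟩ r hr

lemma small (hk : 1 ≤ k) (hn : 1 ≤ n) (hq : 0 < q) (hσ : 0 ≤ σ) (hL : 0 ≤ L)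
    (hL2 : L * 2 ^ q ≤ 1) : ∃ v, Adm v ∧ ∀ r ∈ Icc (0:ℝ) 1, TI n k q σ L v r ≤ v r := by
  have ha : Adm (fun _ => (1:ℝ)) := ⟨fun _ _ _ _ _ => le_rfl, fun _ _ => zero_le_one⟩
  refine ⟨fun _ => 1, ha, fun r hr => ?_⟩
  have : TI n k q σ L (fun _ => 1) r ≤ ∫ s in r..1, (1:ℝ) := by
    apply intervalIntegral.integral_mono_on hr.2
      ((HIc_cont hk hn hq hσ hL ha).intervalIntegrable _ _) (by simp)
    intro t _
    have h1 := HI_le (n := n) hk hn hq hσ hL ha (clp_mem t)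
    have h2 : (L * (1 + 1) ^ q) ^ (1 / (k:ℝ)) ≤ 1 := by
      apply Real.rpow_le_one _ _ (by positivity)
      · positivity
      · norm_num; exact hL2
    have h3 : 0 ≤ (L * (1 + 1) ^ q) ^ (1 / (k:ℝ)) := by positivity
    have h4 := clp_mem t
    nlinarith [h4.1, h4.2]
  refine this.trans ?_
  simp; exact hr.1

end

section
variable {n k : ℕ} {q σ L : ℝ} {v w u : ℝ → ℝ}

lemma cnk_pos (hk : 1 ≤ k) (hn : 2 * k < n) : 0 < cnk n k := by
  have h1 : 0 < n.choose k := Nat.choose_pos (by omega)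
  have h2 : 0 < n := by omega
  unfold cnk
  positivity

lemma rpow_aux {s : ℝ} (hs : 0 < s) (a : ℝ) : s ^ a * s ^ (-a) = 1 := by
  rw [← Real.rpow_add hs]; simp

lemma HI_pow (hk : 1 ≤ k) (hL : 0 ≤ L) (hv : Adm v) {s : ℝ} (hs : s ∈ Ioo (0:ℝ) 1) :
    s ^ ((n:ℝ) - k) * (HI n k q σ L v s) ^ k = L * GI n q σ v s := by
  have h0 := GI_nonneg (n := n) (q := q) (σ := σ) hv (Ioo_subset_Icc_self hs)
  have h2 : 0 ≤ s ^ ((k:ℝ) - n) := Real.rpow_nonneg hs.1.le _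
  unfold HI
  rw [one_div, Real.rpow_inv_natCast_pow (by positivity) (by omega)]
  have := rpow_aux hs.1 ((n:ℝ) - k)
  rw [neg_sub] at this
  linear_combination (L * GI n q σ v s) * this

lemma sol_of_fix (hk : 1 ≤ k) (hn : 2 * k < n) (hq : 0 < q) (hσ : 0 ≤ σ) (hL : 0 < L)
    (hv : Adm v) (hf : ∀ r ∈ Icc (0:ℝ) 1, v r = TI n k q σ L v r) :
    IsRadialSol n k q σ (cnk n k * L) (fun r => - TI n k q σ L v r) := by
  have hn1 : 1 ≤ n := by omega
  have hk' : (0:ℝ) < k := by exact_mod_cast hk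
  have hd := TI_deriv (k := k) hk hn1 hq hσ hL.le hv
  have hde : deriv (fun r => - TI n k q σ L v r) = fun s => HI n k q σ L v (clp s) :=
    funext fun r => (hd r).deriv
  have hdiff : Differentiable ℝ (fun r => - TI n k q σ L v r) := fun r => (hd r).differentiableAt
  have hC1 : ContDiff ℝ 1 (fun r => - TI n k q σ L v r) := by
    rw [contDiff_one_iff_deriv, hde]
    exact ⟨hdiff, HIc_cont hk hn1 hq hσ hL.le hv⟩
  have hTc : Continuous (TI n k q σ L v) := by
    exact continuous_neg_iff.1 hdiff.continuous
  have hvc : ContinuousOn v (Icc 0 1) := hTc.continuousOn.congr hf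
  have hn' : (1:ℝ) ≤ n := by exact_mod_cast hn1
  have hfc : ContinuousOn (fI n q σ v) (Icc 0 1) := by
    unfold fI
    apply ContinuousOn.mul
    · exact (Real.continuous_rpow_const (by linarith)).continuousOn
    · apply ContinuousOn.rpow_const (continuousOn_const.add hvc)
      intro x _; right; exact hq.le
  have hGd : ∀ s ∈ Ioo (0:ℝ) 1, HasDerivAt (GI n q σ v) (fI n q σ v s) s := by
    intro s hs
    have hsI := Icc_mem_nhds hs.1 hs.2
    apply intervalIntegral.integral_hasDerivAt_right
      (fI_int' hn1 hq hσ hv (Ioo_subset_Icc_self hs)) _ (hfc.continuousAt hsI)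
    exact (hfc.mono Ioo_subset_Icc_self).stronglyMeasurableAtFilter isOpen_Ioo s hs
  have hGC : ContDiffOn ℝ 1 (GI n q σ v) (Ioo 0 1) := by
    have := contDiffOn_succ_iff_deriv_of_isOpen (𝕜 := ℝ) (f := GI n q σ v) (n := 0)
      (isOpen_Ioo (a := (0:ℝ)) (b := 1))
    rw [zero_add] at this
    rw [this]
    refine ⟨fun s hs => (hGd s hs).differentiableAt.differentiableWithinAt, by simp, ?_⟩
    rw [contDiffOn_zero]
    exact (hfc.mono Ioo_subset_Icc_self).congr fun s hs => (hGd s hs).deriv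
  have hHC : ContDiffOn ℝ 1 (HI n k q σ L v) (Ioo 0 1) := by
    unfold HI
    apply ContDiffOn.rpow_const_of_ne
    · apply ContDiffOn.mul _ hGC
      apply ContDiffOn.mul contDiffOn_const
      exact contDiffOn_id.rpow_const_of_ne fun x hx => hx.1.ne'
    · intro x hx
      exact (mul_pos (mul_pos hL (Real.rpow_pos_of_pos hx.1 _))
        (GI_pos hn1 hq hσ hv ⟨hx.1, hx.2.le⟩)).ne'
  have hclp : ∀ s ∈ Ioo (0:ℝ) 1, clp s = s := fun s hs => clp_of_mem (Ioo_subset_Icc_self hs)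
  refine ⟨?_, hC1.contDiffOn, ?_, ?_, ?_, ?_, ?_⟩
  · have := contDiffOn_succ_iff_deriv_of_isOpen (𝕜 := ℝ) (f := fun r => - TI n k q σ L v r)
      (n := 1) (isOpen_Ioo (a := (0:ℝ)) (b := 1))
    have h2 : (1:WithTop ℕ∞) + 1 = 2 := one_add_one_eq_two
    rw [h2] at this
    rw [this]
    refine ⟨hdiff.differentiableOn, by simp, ?_⟩
    rw [hde]
    exact hHC.congr fun s hs => by rw [hclp s hs]
  · rw [hde]
    simp only [clp_of_mem (show (0:ℝ) ∈ Icc (0:ℝ) 1 by simp), HI_zero hk]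
  · simp [TI]
  · intro r hr
    have : 0 < TI n k q σ L v r := by
      apply intervalIntegral.intervalIntegral_pos_of_pos_on
        ((HIc_cont hk hn1 hq hσ hL.le hv).intervalIntegrable _ _) _ hr.2
      intro x hx
      have hx' : x ∈ Ioo (0:ℝ) 1 := ⟨hr.1.trans hx.1, hx.2⟩
      simp only [hclp x hx']
      exact HI_pos hn1 hq hσ hL hv ⟨hx'.1, hx'.2.le⟩
    simp only; linarith
  · intro i hi hik r hr
    rw [hde]
    have hmono : MonotoneOn (fun s => s ^ ((n:ℝ) - i) * (HI n k q σ L v (clp s)) ^ i)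
        (Ioo 0 1) := by
      have key : ∀ s ∈ Ioo (0:ℝ) 1, (s ^ ((n:ℝ) - i) * (HI n k q σ L v (clp s)) ^ i) ^ k
          = s ^ (n * (k - i)) * (L * GI n q σ v s) ^ i := by
        intro s hs
        rw [hclp s hs, ← HI_pow hk hL.le hv hs, mul_pow, mul_pow, ← pow_mul, ← pow_mul,
          mul_comm k i, ← mul_assoc]
        congr 1
        rw [← Real.rpow_natCast, ← Real.rpow_natCast, ← Real.rpow_natCast,
          ← Real.rpow_mul hs.1.le, ← Real.rpow_mul hs.1.le, ← Real.rpow_add hs.1]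
        congr 1
        push_cast [hik]
        ring
      intro a ha b hb hab
      have hpb : 0 ≤ b ^ ((n:ℝ) - i) * (HI n k q σ L v (clp b)) ^ i :=
        mul_nonneg (Real.rpow_nonneg hb.1.le _) (pow_nonneg (HI_nonneg hL.le hv (clp_mem b)) _)
      refine le_of_pow_le_pow_left₀ (n := k) (by omega) hpb ?_
      rw [key a ha, key b hb]
      have hG : GI n q σ v a ≤ GI n q σ v b := by
        apply intervalIntegral.integral_mono_interval le_rfl ha.1.le hab
        · filter_upwards [ae_restrict_mem measurableSet_Ioc] with t ht
          exact fI_nonneg hv ⟨ht.1.le, ht.2.trans hb.2.le⟩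
        · exact fI_int' hn1 hq hσ hv (Ioo_subset_Icc_self hb)
      have h0 := GI_nonneg (n := n) (q := q) (σ := σ) hv (Ioo_subset_Icc_self ha)
      have ha0 := ha.1.le
      have hb0 := hb.1.le
      gcongr
    rw [← derivWithin_of_isOpen isOpen_Ioo hr]
    exact hmono.derivWithin_nonneg
  · intro r hr
    have hev : (fun s => s ^ ((n:ℝ) - k) *
        (deriv (fun r => - TI n k q σ L v r) s) ^ k) =ᶠ[nhds r] fun s => L * GI n q σ v s := by
      filter_upwards [Ioo_mem_nhds hr.1 hr.2] with s hs
      rw [hde]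
      simp only [hclp s hs]
      exact HI_pow hk hL.le hv hs
    rw [hev.deriv_eq, ((hGd r hr).const_mul L).deriv, fI, hf r (Ioo_subset_Icc_self hr)]
    have h1 : r ^ (1 - (n:ℝ)) * r ^ ((n:ℝ) - 1 + σ) = r ^ σ := by
      rw [← Real.rpow_add hr.1]; congr 1; ring
    rw [sub_neg_eq_add]
    linear_combination (cnk n k * L * (1 + TI n k q σ L v r) ^ q) * h1

/-- A classical solution satisfies the integral identity. -/
lemma sol_prop (hk : 1 ≤ k) (hn : 2 * k < n) (hq : 0 < q) (hσ : 0 ≤ σ) (hL : 0 < L)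
    (hu : IsRadialSol n k q σ (cnk n k * L) u) :
    Adm (fun r => - u r) ∧ ContinuousOn u (Icc 0 1) ∧
      (∀ r ∈ Ioo (0:ℝ) 1, HasDerivAt u (HI n k q σ L (fun r => - u r) r) r) := by
  obtain ⟨hC2, hC1, -, hu1, -, hmon, heq⟩ := hu
  have hn1 : 1 ≤ n := by omega
  have hnk : (k:ℝ) < n := by exact_mod_cast (show k < n by omega)
  have hn' : (1:ℝ) < n := by exact_mod_cast (show 1 < n by omega)
  have hk' : (0:ℝ) < k := by exact_mod_cast hk
  set D := derivWithin u (Icc 0 1) with hD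
  have hDc : ContinuousOn D (Icc 0 1) :=
    hC1.continuousOn_derivWithin (uniqueDiffOn_Icc zero_lt_one) le_rfl
  have hDeq : ∀ s ∈ Ioo (0:ℝ) 1, D s = deriv u s := fun s hs =>
    derivWithin_of_mem_nhds (Icc_mem_nhds hs.1 hs.2)
  have hud : ∀ s ∈ Ioo (0:ℝ) 1, HasDerivAt u (D s) s := by
    intro s hs
    rw [hDeq s hs]
    exact ((hC2.differentiableOn (by norm_num)).differentiableAt
      (Ioo_mem_nhds hs.1 hs.2)).hasDerivAt
  have hdd : ∀ s ∈ Ioo (0:ℝ) 1, DifferentiableAt ℝ (deriv u) s := by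
    intro s hs
    have h1 : ContDiffOn ℝ 1 (deriv u) (Ioo 0 1) :=
      hC2.deriv_of_isOpen isOpen_Ioo (by norm_num)
    exact (h1.differentiableOn (by norm_num)).differentiableAt (Ioo_mem_nhds hs.1 hs.2)
  have huc : ContinuousOn u (Icc 0 1) := hC1.continuousOn
  have hPd : ∀ i : ℕ, ∀ s ∈ Ioo (0:ℝ) 1, HasDerivAt (fun s => s ^ ((n : ℝ) - i) * (D s) ^ i)
      (deriv (fun s => s ^ ((n : ℝ) - i) * (deriv u s) ^ i) s) s := by
    intro i s hs
    have h1 : DifferentiableAt ℝ (fun s => s ^ ((n : ℝ) - i) * (deriv u s) ^ i) s :=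
      (differentiableAt_id.rpow_const (Or.inl hs.1.ne')).mul ((hdd s hs).pow i)
    apply h1.hasDerivAt.congr_of_eventuallyEq
    filter_upwards [Ioo_mem_nhds hs.1 hs.2] with t ht
    rw [hDeq t ht]
  have hPc : ∀ i : ℕ, i ≤ k → ContinuousOn (fun s => s ^ ((n : ℝ) - i) * (D s) ^ i) (Icc 0 1) := by
    intro i hi
    have : (i:ℝ) ≤ k := by exact_mod_cast hi
    exact (Real.continuous_rpow_const (by linarith)).continuousOn.mul (hDc.pow i)
  have hDnn : ∀ s ∈ Ioo (0:ℝ) 1, 0 ≤ D s := by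
    intro s hs
    have hm : MonotoneOn (fun s => s ^ ((n : ℝ) - (1:ℕ)) * (D s) ^ 1) (Icc 0 1) := by
      apply monotoneOn_of_deriv_nonneg (convex_Icc 0 1) (hPc 1 hk)
      · rw [interior_Icc]
        exact fun s hs => (hPd 1 s hs).differentiableAt.differentiableWithinAt
      · rw [interior_Icc]
        intro s hs
        rw [(hPd 1 s hs).deriv]
        exact hmon 1 le_rfl hk s hs
    have := hm (show (0:ℝ) ∈ Icc (0:ℝ) 1 by simp) (Ioo_subset_Icc_self hs) hs.1.le
    simp only [pow_one, Nat.cast_one] at this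
    rw [Real.zero_rpow (by linarith), zero_mul] at this
    exact nonneg_of_mul_nonneg_right this (Real.rpow_pos_of_pos hs.1 _)
  have hum : MonotoneOn u (Icc 0 1) := by
    apply monotoneOn_of_deriv_nonneg (convex_Icc 0 1) huc
    · rw [interior_Icc]
      exact fun s hs => (hud s hs).differentiableAt.differentiableWithinAt
    · rw [interior_Icc]
      intro s hs
      rw [(hud s hs).deriv]
      exact hDnn s hs
  have hadm : Adm (fun r => - u r) := by
    refine ⟨fun a ha b hb hab => neg_le_neg (hum ha hb hab), fun r hr => ?_⟩
    have := hum hr (by simp) hr.2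
    simp only; linarith
  refine ⟨hadm, huc, fun r hr => ?_⟩
  have hc := cnk_pos hk hn
  have hder : ∀ s ∈ Ioo (0:ℝ) 1, deriv (fun s => s ^ ((n : ℝ) - k) * (deriv u s) ^ k) s
      = L * fI n q σ (fun r => - u r) s := by
    intro s hs
    have h1 := heq s hs
    have h2 : s ^ ((n:ℝ) - 1) * s ^ (1 - (n:ℝ)) = 1 := by
      rw [← Real.rpow_add hs.1]; simp
    have h3 : s ^ ((n:ℝ) - 1 + σ) = s ^ ((n:ℝ) - 1) * s ^ σ := Real.rpow_add hs.1 _ _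
    unfold fI
    rw [h3, ← sub_eq_add_neg]
    apply mul_left_cancel₀ hc.ne'
    set P := deriv (fun s => s ^ ((n : ℝ) - k) * (deriv u s) ^ k) s
    linear_combination s ^ ((n:ℝ) - 1) * h1 - cnk n k * P * h2
  have hFTC := intervalIntegral.integral_eq_sub_of_hasDerivAt_of_le hr.1.le
    (f := fun s => s ^ ((n : ℝ) - k) * (D s) ^ k)
    (f' := fun s => L * fI n q σ (fun r => - u r) s)
    ((hPc k le_rfl).mono (Icc_subset_Icc le_rfl hr.2.le))
    (fun s hs => by
      have hs' : s ∈ Ioo (0:ℝ) 1 := ⟨hs.1, hs.2.trans hr.2⟩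
      rw [← hder s hs']
      exact hPd k s hs')
    ((fI_int' hn1 hq hσ hadm (Ioo_subset_Icc_self hr)).const_mul L)
  rw [intervalIntegral.integral_const_mul, Real.zero_rpow (by linarith), zero_mul, sub_zero]
    at hFTC
  have hH := HI_pow (n := n) (q := q) (σ := σ) hk hL.le hadm hr
  have hDH : D r = HI n k q σ L (fun r => - u r) r := by
    have : r ^ ((n:ℝ) - k) * (D r) ^ k = r ^ ((n:ℝ) - k) * HI n k q σ L (fun r => - u r) r ^ k := by
      rw [hH, ← hFTC]; rfl
    have := mul_left_cancel₀ (Real.rpow_pos_of_pos hr.1 _).ne' this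
    exact (pow_left_inj₀ (hDnn r hr)
      (HI_nonneg hL.le hadm (Ioo_subset_Icc_self hr)) (by omega)).1 this
  rw [← hDH]
  exact hud r hr

lemma sol_super (hk : 1 ≤ k) (hn : 2 * k < n) (hq : 0 < q) (hσ : 0 ≤ σ) (hL : 0 < L)
    (hu : IsRadialSol n k q σ (cnk n k * L) u) {r : ℝ} (hr : r ∈ Icc (0:ℝ) 1) :
    TI n k q σ L (fun r => - u r) r = - u r := by
  obtain ⟨ha, hc, hd⟩ := sol_prop hk hn hq hσ hL hu
  have hu1 : u 1 = 0 := hu.2.2.2.1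
  have := intervalIntegral.integral_eq_sub_of_hasDerivAt_of_le hr.2 (f := u)
    (f' := fun s => HI n k q σ L (fun r => - u r) (clp s))
    (hc.mono (Icc_subset_Icc hr.1 le_rfl))
    (fun s hs => by
      have hs' : s ∈ Ioo (0:ℝ) 1 := ⟨hr.1.trans_lt hs.1, hs.2⟩
      rw [clp_of_mem (Ioo_subset_Icc_self hs')]
      exact hd s hs')
    ((HIc_cont hk (by omega) hq hσ hL.le ha).intervalIntegrable _ _)
  unfold TI
  rw [this, hu1, zero_sub]

lemma down (hk : 1 ≤ k) (hn : 2 * k < n) (hq : 0 < q) (hσ : 0 ≤ σ) {L' : ℝ} (hL : 0 < L)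
    (hLL : L ≤ L') (hu : IsRadialSol n k q σ (cnk n k * L') u) :
    ∃ u, IsRadialSol n k q σ (cnk n k * L) u := by
  have hL' := hL.trans_le hLL
  have ha := (sol_prop hk hn hq hσ hL' hu).1
  obtain ⟨w, hw, hf⟩ := fixpoint (n := n) hk (by omega) hq hσ hL.le ha fun r hr =>
    (TI_mono hk (by omega) hq hσ hL.le hLL ha ha (fun _ _ => le_rfl) hr).trans
      (sol_super hk hn hq hσ hL' hu hr).le
  exact ⟨_, sol_of_fix hk hn hq hσ hL hw hf⟩

lemma GI_ge (hn : 1 ≤ n) (hq : 0 < q) (hσ : 0 ≤ σ) (hv : Adm v) {s : ℝ} (hs : s ∈ Icc (0:ℝ) 1) :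
    (1 + v s) ^ q * (s ^ ((n:ℝ) + σ) / (n + σ)) ≤ GI n q σ v s := by
  have hn' : (1:ℝ) ≤ n := by exact_mod_cast hn
  have h1 : ∫ t in (0:ℝ)..s, t ^ ((n:ℝ) - 1 + σ) * (1 + v s) ^ q ≤ GI n q σ v s := by
    apply intervalIntegral.integral_mono_on hs.1 _ (fI_int' hn hq hσ hv hs)
    · intro t ht
      have := hv.1 ⟨ht.1, ht.2.trans hs.2⟩ hs ht.2
      have h2 := hv.2 s hs
      exact mul_le_mul_of_nonneg_left (Real.rpow_le_rpow (by linarith) (by linarith) hq.le)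
        (Real.rpow_nonneg ht.1 _)
    · apply Continuous.intervalIntegrable
      exact (Real.continuous_rpow_const (by linarith)).mul continuous_const
  refine le_trans (le_of_eq ?_) h1
  rw [intervalIntegral.integral_mul_const, integral_rpow (Or.inl (by linarith)),
    Real.zero_rpow (by linarith)]
  rw [show (n:ℝ) - 1 + σ + 1 = n + σ by ring]
  ring

lemma bound (hk : 1 ≤ k) (hn : 2 * k < n) (hq : (k:ℝ) < q) (hσ : 0 ≤ σ) (hL : 0 < L)
    (hu : IsRadialSol n k q σ (cnk n k * L) u) :
    L ≤ (2 / (q / k - 1)) ^ (k:ℝ) * ((n + σ) / (1 / 2) ^ ((k:ℝ) + σ)) := by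
  have hk' : (0:ℝ) < k := by exact_mod_cast hk
  have hn1 : 1 ≤ n := by omega
  have hn' : (1:ℝ) ≤ n := by exact_mod_cast hn1
  have hq0 : 0 < q := hk'.trans hq
  obtain ⟨ha, hc, hd⟩ := sol_prop hk hn hq0 hσ hL hu
  have hu1 : u 1 = 0 := hu.2.2.2.1
  have hb : 0 < q / k - 1 := by rw [sub_pos, lt_div_iff₀ hk']; linarith
  set b := q / k - 1 with hbdef
  set A := L * ((1 / 2) ^ ((k:ℝ) + σ) / (n + σ)) with hA
  have hA0 : 0 < A := by positivity
  have hup : ∀ s ∈ Icc (0:ℝ) 1, 1 ≤ 1 - u s := fun s hs => by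
    have := ha.2 s hs; simp only at this; linarith
  -- slope lower bound
  have hslope : ∀ s ∈ Ioo (1/2:ℝ) 1, A ^ (1 / (k:ℝ)) * (1 - u s) ^ (q / k) ≤
      HI n k q σ L (fun r => - u r) s := by
    intro s hs
    have hs0 : 0 < s := by linarith [hs.1]
    have hsI : s ∈ Icc (0:ℝ) 1 := ⟨hs0.le, hs.2.le⟩
    have h1 := GI_ge (n := n) hn1 hq0 hσ ha hsI
    have h1u := hup s hsI
    rw [← sub_eq_add_neg] at h1
    have h2 : (1 - u s) ^ (q / k) = ((1 - u s) ^ q) ^ (1 / (k:ℝ)) := by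
      rw [← Real.rpow_mul (by linarith)]; congr 1; ring
    have h3 : 0 ≤ (1 - u s) ^ q := Real.rpow_nonneg (by linarith) _
    rw [h2, ← Real.mul_rpow hA0.le h3]
    unfold HI
    apply Real.rpow_le_rpow (by positivity) _ (by positivity)
    have h4 : (1/2:ℝ) ^ ((k:ℝ) + σ) ≤ s ^ ((k:ℝ) - n) * s ^ ((n:ℝ) + σ) := by
      rw [← Real.rpow_add hs0, show (k:ℝ) - n + (n + σ) = k + σ by ring]
      exact Real.rpow_le_rpow (by norm_num) hs.1.le (by positivity)
    calc A * (1 - u s) ^ q = L * ((1/2:ℝ) ^ ((k:ℝ) + σ) / (n + σ)) * (1 - u s) ^ q := rfl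
      _ ≤ L * (s ^ ((k:ℝ) - n) * s ^ ((n:ℝ) + σ) / (n + σ)) * (1 - u s) ^ q := by gcongr
      _ = L * s ^ ((k:ℝ) - n) * ((1 - u s) ^ q * (s ^ ((n:ℝ) + σ) / (n + σ))) := by ring
      _ ≤ _ := by
        have : 0 ≤ s ^ ((k:ℝ) - n) := Real.rpow_nonneg hs0.le _
        gcongr
  -- mean value
  have hgc : ContinuousOn (fun s => (1 - u s) ^ (-b)) (Icc (1/2) 1) := by
    apply ContinuousOn.rpow_const
    · exact continuousOn_const.sub (hc.mono (Icc_subset_Icc (by norm_num) le_rfl))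
    · intro x hx
      left
      have := hup x ⟨by linarith [hx.1], hx.2⟩
      linarith
  have hgd : ∀ s ∈ Ioo (1/2:ℝ) 1, HasDerivAt (fun s => (1 - u s) ^ (-b))
      (b * (1 - u s) ^ (-(q / k)) * HI n k q σ L (fun r => - u r) s) s := by
    intro s hs
    have hs' : s ∈ Ioo (0:ℝ) 1 := ⟨by linarith [hs.1], hs.2⟩
    have := hup s (Ioo_subset_Icc_self hs')
    have h1 := ((hd s hs').const_sub 1).rpow_const (p := -b) (Or.inl (by linarith))
    convert h1 using 1
    rw [show -b - 1 = -(q / k) by rw [hbdef]; ring]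
    ring
  obtain ⟨x, hx, hxe⟩ := exists_hasDerivAt_eq_slope _ _ (by norm_num : (1/2:ℝ) < 1) hgc hgd
  have hxI : x ∈ Icc (0:ℝ) 1 := ⟨by linarith [hx.1], hx.2.le⟩
  have hux := hup x hxI
  have h5 := hslope x hx
  have h6 : (1 - u x) ^ (q / k) * (1 - u x) ^ (-(q / k)) = 1 := rpow_aux (by linarith) _
  have h7 : 0 ≤ (1 - u x) ^ (-(q / k)) := Real.rpow_nonneg (by linarith) _
  have h8 : b * A ^ (1 / (k:ℝ)) ≤ 2 := by
    have e1 : b * A ^ (1 / (k:ℝ)) ≤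
        b * (1 - u x) ^ (-(q / k)) * HI n k q σ L (fun r => - u r) x := by
      calc b * A ^ (1 / (k:ℝ)) = b * (1 - u x) ^ (-(q / k)) *
          (A ^ (1 / (k:ℝ)) * (1 - u x) ^ (q / k)) := by
            linear_combination - (b * A ^ (1 / (k:ℝ))) * h6
        _ ≤ _ := by gcongr
    rw [hxe, hu1] at e1
    have h9 : 0 ≤ (1 - u (1/2)) ^ (-b) :=
      Real.rpow_nonneg (by linarith [hup (1/2) ⟨by norm_num, by norm_num⟩]) _
    rw [sub_zero, Real.one_rpow] at e1
    norm_num at e1 h9 ⊢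
    linarith
  have h10 : A ^ (1 / (k:ℝ)) ≤ 2 / b := by rw [le_div_iff₀ hb]; linarith
  have h11 : A ≤ (2 / b) ^ (k:ℝ) := by
    have := Real.rpow_le_rpow (by positivity) h10 hk'.le
    rwa [← Real.rpow_mul hA0.le, one_div_mul_cancel hk'.ne', Real.rpow_one] at this
  have h12 : L = A * ((n + σ) / (1 / 2) ^ ((k:ℝ) + σ)) := by
    rw [hA]
    have : (0:ℝ) < (1/2:ℝ) ^ ((k:ℝ) + σ) := by positivity
    have : (0:ℝ) < n + σ := by linarith
    field_simp
  rw [h12]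
  gcongr

end

/-- there is a finite extremal parameter `λ* > 0` such that `(P_λ)` has a
classical radial solution for every `0 < λ < λ*` and no classical radial solution for
`λ > λ*`. -/
theorem extremal_parameter_exists (n k : ℕ) (hk : 1 ≤ k) (hn : 2 * k < n)
    (q σ : ℝ) (hq : (k : ℝ) < q) (hσ : 0 ≤ σ) :
    ∃ lamStar : ℝ, 0 < lamStar ∧
      (∀ lam : ℝ, 0 < lam → lam < lamStar → ∃ u : ℝ → ℝ, IsRadialSol n k q σ lam u) ∧
      (∀ lam : ℝ, lamStar < lam → ¬ ∃ u : ℝ → ℝ, IsRadialSol n k q σ lam u) := by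
  have hc := cnk_pos hk hn
  have hk' : (0:ℝ) < k := by exact_mod_cast hk
  have hq0 : 0 < q := hk'.trans hq
  set B : ℝ := (2 / (q / k - 1)) ^ (k:ℝ) * ((n + σ) / (1 / 2) ^ ((k:ℝ) + σ)) with hB
  let S : Set ℝ := {l | 0 < l ∧ ∃ u, IsRadialSol n k q σ l u}
  have hre : ∀ l : ℝ, cnk n k * (l / cnk n k) = l := fun l => mul_div_cancel₀ l hc.ne'
  have hbdd : BddAbove S := by
    refine ⟨cnk n k * B, ?_⟩
    rintro l ⟨hl, u, hu⟩
    rw [← hre l] at hu ⊢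
    exact mul_le_mul_of_nonneg_left (bound hk hn hq hσ (div_pos hl hc) hu) hc.le
  have h2q : (0:ℝ) < 2 ^ q := by positivity
  have hl0 : cnk n k * (1 / 2 ^ q) ∈ S := by
    refine ⟨by positivity, ?_⟩
    have hL : (0:ℝ) < 1 / 2 ^ q := by positivity
    obtain ⟨v, hv, hs⟩ := small (n := n) (k := k) (q := q) (σ := σ) hk (by omega) hq0 hσ hL.le
      (by rw [one_div_mul_cancel h2q.ne'])
    obtain ⟨w, hw, hf⟩ := fixpoint hk (by omega) hq0 hσ hL.le hv hs
    exact ⟨_, sol_of_fix hk hn hq0 hσ hL hw hf⟩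
  have hpos : 0 < sSup S := hl0.1.trans_le (le_csSup hbdd hl0)
  refine ⟨sSup S, hpos, ?_, ?_⟩
  · intro l hl hlt
    obtain ⟨l', ⟨hl', u, hu⟩, hll⟩ := exists_lt_of_lt_csSup ⟨_, hl0⟩ hlt
    rw [← hre l'] at hu
    rw [← hre l]
    exact down hk hn hq0 hσ (div_pos hl hc) (div_le_div_of_nonneg_right hll.le hc.le) hu
  · intro l hlt hu
    exact absurd (le_csSup hbdd ⟨hpos.trans hlt, hu⟩) (not_le.2 hlt)
end
end

section
/- Let q = q*(k,σ) and let 0 < λ < μ*(k,σ) := binom(n,k)·((n+σ)/n)·(n-2k)^k/(k+1)^{k+1}. Then the radial problem (P_λ) has exactly two classical radial solutions, namely u(r) = 1 + w_{1/d_-}(r) and u(r) = 1 + w_{1/d_+}(r), where d_- < d_+ are the two positive roots of λ(d+1)^{k+1} = binom(n,k)·((n-2k)/k)^k·((n+σ)/n)·d^k, and where w_c(r) = -λ^{-(n-2k)/((2k+σ)(k+1))} · [c · binom(n,k) · ((n+σ)/n) · ((n-2k)/k)^k]^{(n-2k)/((2k+σ)(k+1))} · (c + r^{(2k+σ)/k})^{-(n-2k)/(2k+σ)}.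 -/
open Real Set Filter MeasureTheory

noncomputable section

/-- The Bliss-type function `w_c`. -/
def wFun (n k : ℕ) (σ lam c : ℝ) : ℝ → ℝ := fun r =>
  -(lam ^ (-(((n : ℝ) - 2 * k) / ((2 * (k : ℝ) + σ) * ((k : ℝ) + 1)))) *
    (c * (n.choose k : ℝ) * (((n : ℝ) + σ) / n) * (((n : ℝ) - 2 * k) / k) ^ k) ^
      (((n : ℝ) - 2 * k) / ((2 * (k : ℝ) + σ) * ((k : ℝ) + 1))) *
    (c + r ^ ((2 * (k : ℝ) + σ) / k)) ^ (-(((n : ℝ) - 2 * k) / (2 * (k : ℝ) + σ))))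

lemma roots_aux (k : ℕ) (hk : 1 ≤ k) (lam B : ℝ) (hl : 0 < lam)
    (hB : lam * ((k:ℝ)+1)^(k+1) < B * (k:ℝ)^k) :
    ∃ dm dp : ℝ, 0 < dm ∧ dm < dp ∧ lam * (dm+1)^(k+1) = B * dm^k ∧
      lam * (dp+1)^(k+1) = B * dp^k ∧
      ∀ d : ℝ, 0 < d → lam * (d+1)^(k+1) = B * d^k → d = dm ∨ d = dp := by
  have hk0 : (0:ℝ) < k := by exact_mod_cast hk
  have hB0 : 0 < B := by
    by_contra h
    have h1 : B * (k:ℝ)^k ≤ 0 := mul_nonpos_of_nonpos_of_nonneg (not_lt.1 h) (by positivity)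
    have h2 : 0 < lam * ((k:ℝ)+1)^(k+1) := by positivity
    linarith
  have hcont : Continuous (fun d : ℝ => lam * (d+1)^(k+1) - B * d^k) := by fun_prop
  have hkB : (k:ℝ) < B / lam := by
    rw [lt_div_iff₀ hl]
    have h1 : lam * (k:ℝ)^(k+1) < B * (k:ℝ)^k := by
      refine lt_of_le_of_lt ?_ hB
      gcongr; linarith
    have h2 : (k:ℝ)^k * (k * lam) < (k:ℝ)^k * B := by
      calc _ = lam * (k:ℝ)^(k+1) := by ring
        _ < _ := by linarith
    exact lt_of_mul_lt_mul_left h2 (by positivity)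
  obtain ⟨dm, hdm, hdm0⟩ := intermediate_value_Icc' hk0.le hcont.continuousOn
    (show (0:ℝ) ∈ Icc _ _ by
      constructor
      · linarith
      · have : k ≠ 0 := by omega
        simp [this, hl.le])
  obtain ⟨dp, hdp, hdp0⟩ := intermediate_value_Icc hkB.le hcont.continuousOn
    (show (0:ℝ) ∈ Icc _ _ by
      constructor
      · linarith
      · have h3 : lam * (B/lam)^(k+1) = B * (B/lam)^k := by
          rw [pow_succ]; field_simp
        have h4 : lam * (B/lam)^(k+1) ≤ lam * (B/lam+1)^(k+1) := by
          have : 0 < B / lam := by positivity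
          gcongr; linarith
        linarith)
  have hdmne : dm ≠ 0 := by
    rintro rfl
    have : k ≠ 0 := by omega
    simp [this] at hdm0
    exact hl.ne' hdm0
  have hdmk : dm ≠ k := by rintro rfl; linarith
  have hdpk : dp ≠ k := by rintro rfl; linarith
  have hdm1 : 0 < dm := lt_of_le_of_ne hdm.1 hdmne.symm
  have hdm2 : dm < k := lt_of_le_of_ne hdm.2 hdmk
  have hdp2 : (k:ℝ) < dp := lt_of_le_of_ne hdp.1 hdpk.symm
  -- monotonicity
  let φ : ℝ → ℝ := fun d => d^k / (d+1)^(k+1)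
  have hφd : ∀ d : ℝ, 0 < d → HasDerivAt φ (d^(k-1) * (d+1)^k * (k-d) / ((d+1)^(k+1))^2) d := by
    intro d hd
    have h1 := ((hasDerivAt_pow k d).div (((hasDerivAt_id d).add_const 1).pow (k+1))
      (by simp; positivity))
    refine HasDerivAt.congr_deriv h1 ?_
    obtain ⟨j, rfl⟩ : ∃ j, k = j+1 := ⟨k-1, by omega⟩
    simp
    ring
  have hφc : ∀ s : Set ℝ, (∀ x ∈ s, 0 < x) → ContinuousOn φ s := fun s hs x hx =>
    (hφd x (hs x hx)).continuousAt.continuousWithinAt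
  have hmono : StrictMonoOn φ (Ioc 0 (k:ℝ)) := by
    apply strictMonoOn_of_deriv_pos (convex_Ioc _ _) (hφc _ fun x hx => hx.1)
    intro x hx
    rw [interior_Ioc] at hx
    rw [(hφd x hx.1).deriv]
    have := hx.1
    have : 0 < (k:ℝ) - x := by linarith [hx.2]
    positivity
  have hanti : StrictAntiOn φ (Ici (k:ℝ)) := by
    apply strictAntiOn_of_deriv_neg (convex_Ici _) (hφc _ fun x hx => hk0.trans_le hx)
    intro x hx
    rw [interior_Ici] at hx
    have h0 : (k:ℝ) < x := hx
    have h1 : 0 < x := hk0.trans h0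
    rw [(hφd x h1).deriv]
    apply div_neg_of_neg_of_pos _ (by positivity)
    apply mul_neg_of_pos_of_neg (by positivity) (by linarith)
  have hφv : ∀ d : ℝ, 0 < d → lam * (d+1)^(k+1) = B * d^k → φ d = lam / B := by
    intro d hd h
    simp only [φ]
    rw [div_eq_div_iff (by positivity) hB0.ne']; linarith
  refine ⟨dm, dp, hdm1, hdm2.trans hdp2, by linarith, by linarith, ?_⟩
  intro d hd h
  rcases le_or_gt d k with h1 | h1
  · left
    exact hmono.injOn ⟨hd, h1⟩ ⟨hdm1, hdm2.le⟩
      ((hφv d hd h).trans (hφv dm hdm1 (by linarith)).symm)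
  · right
    exact hanti.injOn h1.le hdp2.le
      ((hφv d hd h).trans (hφv dp (hk0.trans hdp2) (by linarith)).symm)

lemma deriv_w (A c p y r : ℝ) (hc : 0 < c) (hr : 0 ≤ r) (hy : 1 < y) :
    HasDerivAt (fun r : ℝ => 1 + -(A * (c + r^y)^(-p)))
      (A*p*y*r^(y-1)*(c+r^y)^(-p-1)) r := by
  have h0 : 0 ≤ r^y := rpow_nonneg hr _
  have h1 : HasDerivAt (fun r : ℝ => c + r^y) (y*r^(y-1)) r :=
    (Real.hasDerivAt_rpow_const (Or.inr hy.le)).const_add c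
  have h2 := ((h1.rpow_const (p := -p) (Or.inl (by positivity))).const_mul A).neg.const_add 1
  refine HasDerivAt.congr_deriv h2 ?_
  ring

lemma deriv_i (D c m y e r : ℝ) (hc : 0 < c) (hr : 0 < r) :
    HasDerivAt (fun s : ℝ => D * (s^e * (c+s^y)^(-m)))
      (D * (r^(e-1) * (c+r^y)^(-m-1) * (e*c + (e - m*y)*r^y))) r := by
  have h0 : 0 < r^y := rpow_pos_of_pos hr _
  have hG : 0 < c + r^y := by positivity
  have h1 : HasDerivAt (fun r : ℝ => c + r^y) (y*r^(y-1)) r :=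
    (Real.hasDerivAt_rpow_const (Or.inl hr.ne')).const_add c
  have h2 := (((Real.hasDerivAt_rpow_const (p := e) (Or.inl hr.ne')).mul
    (h1.rpow_const (p := -m) (Or.inl hG.ne')))).const_mul D
  refine HasDerivAt.congr_deriv h2 ?_
  have e1 : r^e = r^(e-1) * r := by
    rw [← rpow_add_one hr.ne']; ring_nf
  have e2 : r^y = r^(y-1) * r := by
    rw [← rpow_add_one hr.ne']; ring_nf
  have e3 : (c+r^y)^(-m) = (c+r^y)^(-m-1) * (c+r^y) := by
    rw [← rpow_add_one hG.ne']; ring_nf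
  rw [e3, e1]
  generalize (c+r^y)^(-m-1) = Z
  rw [e2]
  ring

lemma isSol (n k : ℕ) (hk : 1 ≤ k) (hn : 2 * k < n) (σ : ℝ) (hσ : 0 ≤ σ) (lam : ℝ)
    (y p q A c : ℝ)
    (hy : (k:ℝ)*y = 2*k+σ) (hp : p*(2*k+σ) = n - 2*k)
    (hq : q * ((n:ℝ)-2*k) = (n+2)*k+σ*(k+1)) (hA : 0 < A) (hc : 0 < c)
    (hA1 : A * (c+1)^(-p) = 1)
    (hA2 : (n.choose k : ℝ) * (((n : ℝ) + σ) / n) * (((n : ℝ) - 2 * k) / k) ^ k * c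
      = lam * A^(q-k)) :
    IsRadialSol n k q σ lam (fun r => 1 + -(A * (c + r^y)^(-p))) := by
  have hk0 : (0:ℝ) < k := by exact_mod_cast hk
  have hk1 : (1:ℝ) ≤ k := by exact_mod_cast hk
  have hn0 : (0:ℝ) < (n:ℝ) - 2*k := by
    have : ((2*k:ℕ):ℝ) < n := by exact_mod_cast hn
    push_cast at this; linarith
  have hnpos : (0:ℝ) < n := by linarith
  have hy2 : 2 ≤ y := by
    by_contra h
    nlinarith
  have hp0 : 0 < p := by
    by_contra h
    nlinarith
  have hpy : p * y * k = n - 2*k := by rw [← hp, ← hy]; ring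
  have hG : ∀ r : ℝ, 0 ≤ r → 0 < c + r^y := fun r hr => by
    have := rpow_nonneg hr y
    positivity
  have hC2 : ContDiffOn ℝ 2 (fun r : ℝ => 1 + -(A * (c + r^y)^(-p))) (Icc 0 1) := by
    have h1 : ContDiff ℝ 2 (fun r : ℝ => c + r^y) :=
      contDiff_const.add (Real.contDiff_rpow_const_of_le (by exact_mod_cast hy2))
    refine contDiffOn_const.add (ContDiffOn.neg (contDiffOn_const.mul ?_))
    exact h1.contDiffOn.rpow_const_of_ne fun x hx => (hG x hx.1).ne'
  have hD : ∀ r : ℝ, 0 ≤ r → deriv (fun r : ℝ => 1 + -(A * (c + r^y)^(-p))) r =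
      A*p*y*r^(y-1)*(c+r^y)^(-p-1) := fun r hr =>
    (deriv_w A c p y r hc hr (by linarith)).deriv
  have hDi : ∀ i : ℕ, ∀ r : ℝ, 0 < r →
      deriv (fun s => s ^ ((n : ℝ) - i) *
        (deriv (fun r : ℝ => 1 + -(A * (c + r^y)^(-p))) s) ^ i) r =
      (A*p*y)^i * (r^(((n:ℝ)-i+i*(y-1))-1) * (c+r^y)^(-(i*(p+1))-1) *
        (((n:ℝ)-i+i*(y-1))*c + (((n:ℝ)-i+i*(y-1)) - (i*(p+1))*y)*r^y)) := by
    intro i r hr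
    rw [← (deriv_i ((A*p*y)^i) c (i*(p+1)) y ((n:ℝ)-i+i*(y-1)) r hc hr).deriv]
    apply Filter.EventuallyEq.deriv_eq
    filter_upwards [lt_mem_nhds hr] with s hs
    rw [hD s hs.le, mul_pow, mul_pow, rpow_add hs, ← rpow_natCast (s^(y-1)), ← rpow_mul hs.le,
      ← rpow_natCast ((c+s^y)^(-p-1)), ← rpow_mul (hG s hs.le).le]
    have e1 : (y-1)*(i:ℝ) = i*(y-1) := by ring
    have e2 : (-p-1)*(i:ℝ) = -(i*(p+1)) := by ring
    rw [e1, e2]; ring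
  refine ⟨hC2.mono Ioo_subset_Icc_self, hC2.of_le (by norm_num), ?_, ?_, ?_, ?_, ?_⟩
  · rw [hD 0 le_rfl, zero_rpow (by linarith)]; simp
  · simp [hA1]
  · intro r hr
    have h1 : r^y < 1 := rpow_lt_one hr.1.le hr.2 (by linarith)
    have h2 : (c+1)^(-p) < (c+r^y)^(-p) :=
      rpow_lt_rpow_of_neg (hG r hr.1.le) (by linarith) (by linarith)
    have := mul_lt_mul_of_pos_left h2 hA

    linarith
  · intro i hi1 hik r hr
    rw [hDi i r hr.1]
    have hi0 : (0:ℝ) ≤ i := by positivity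
    have hik' : (i:ℝ) ≤ k := by exact_mod_cast hik
    have h1 := hG r hr.1.le
    have h2 : 0 ≤ ((n:ℝ)-i+i*(y-1)) := by nlinarith
    have h3 : 0 ≤ ((n:ℝ)-i+i*(y-1)) - (i*(p+1))*y := by
      have : k * (((n:ℝ)-i+i*(y-1)) - (i*(p+1))*y) = n * (k - i) := by
        have : k * (((n:ℝ)-i+i*(y-1)) - (i*(p+1))*y) = k * (n - 2*i) - i * (p*y*k) := by ring
        rw [this, hpy]; ring
      have h4 : 0 ≤ k * (((n:ℝ)-i+i*(y-1)) - (i*(p+1))*y) := by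
        rw [this]; exact mul_nonneg hnpos.le (by linarith)
      exact nonneg_of_mul_nonneg_right h4 hk0
    have h5 := hr.1
    have h6 : 0 < y := by linarith
    positivity
  · intro r hr
    have hr0 := hr.1
    rw [hDi k r hr0]
    have e1 : (n:ℝ)-k+k*(y-1) = n+σ := by linarith
    have e2 : k*(p+1)*y = n+σ := by
      have : k*(p+1)*y = p*y*k + k*y := by ring
      rw [this, hpy, hy]; ring
    have h2kσ : 0 < 2*(k:ℝ)+σ := by positivity
    have e3 : p*q = k*(p+1)+1 := by
      have h1 : p * q * (n - 2*k) = (k*(p+1)+1) * (n-2*k) := by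
        rw [mul_assoc, hq]
        linear_combination ((k:ℝ)+1) * hp
      exact mul_right_cancel₀ hn0.ne' h1
    rw [e1, e2]
    have hv : (1 - (1 + -(A * (c + r^y)^(-p))))^q = A^q * (c+r^y)^(-(k*(p+1))-1) := by
      have : (1 - (1 + -(A * (c + r^y)^(-p)))) = A * (c + r^y)^(-p) := by ring
      have h7 := hG r hr0.le
      rw [this, mul_rpow hA.le (by positivity), ← rpow_mul h7.le]
      congr 2
      linarith
    rw [hv]
    have e4 : r ^ (1-(n:ℝ)) * r^((n:ℝ)+σ-1) = r^σ := by
      rw [← rpow_add hr0]; ring_nf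
    have e5 : A^q = A^(q-k) * A^k := by
      rw [← rpow_natCast A k, ← rpow_add hA]; ring_nf
    have e6 : (A*p*y)^k = A^k * (((n:ℝ)-2*k)/k)^k := by
      rw [← mul_pow]; congr 1
      rw [← hpy]; field_simp
    rw [e6, e5, sub_self, zero_mul, add_zero]
    calc _ = (r ^ (1-(n:ℝ)) * r^((n:ℝ)+σ-1)) * ((n.choose k : ℝ) * (((n : ℝ) + σ) / n) * (((n : ℝ) - 2 * k) / k) ^ k * c) * A^k * (c+r^y)^(-(k*(p+1))-1) := by
          rw [cnk]; ring
      _ = _ := by rw [e4, hA2]; ring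

lemma const_aux (f : ℝ → ℝ) (a b : ℝ) (hab : a ≤ b) (hc : ContinuousOn f (Icc a b))
    (hd : ∀ x ∈ Ioo a b, HasDerivAt f 0 x) : f a = f b := by
  rcases hab.eq_or_lt with rfl | h
  · rfl
  obtain ⟨x, hx, h1⟩ := exists_hasDerivAt_eq_slope f (fun _ => 0) h hc hd
  have : b - a ≠ 0 := by linarith
  field_simp at h1
  linarith

lemma unique_aux (n k : ℕ) (hk : 1 ≤ k) (hn : 2 * k < n) (σ : ℝ) (hσ : 0 ≤ σ) (lam : ℝ)
    (hlam : 0 < lam) (y p q : ℝ)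
    (hy : (k:ℝ)*y = 2*k+σ) (hp : p*(2*k+σ) = n - 2*k)
    (hq : q * ((n:ℝ)-2*k) = (n+2)*k+σ*(k+1)) (u : ℝ → ℝ) (hu : IsRadialSol n k q σ lam u) :
    ∃ g b : ℝ, 0 < g ∧ 0 < b ∧ g + b = 1 ∧
      lam = g * b^k * ((n.choose k : ℝ) * (((n : ℝ) - 2 * k) / k) ^ k * (((n : ℝ) + σ) / n)) ∧
      ∀ r ∈ Icc (0:ℝ) 1, u r = 1 - (g + b * r^y)^(-p) := by
  obtain ⟨hC2, hC1, -, hu1, huneg, hmon, hode⟩ := hu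
  have hk0 : (0:ℝ) < k := by exact_mod_cast hk
  have hk1 : (1:ℝ) ≤ k := by exact_mod_cast hk
  have hn0 : (0:ℝ) < (n:ℝ) - 2*k := by
    have : ((2*k:ℕ):ℝ) < n := by exact_mod_cast hn
    push_cast at this; linarith
  have hnpos : (0:ℝ) < n := by linarith
  have hy2 : 2 ≤ y := by
    by_contra h
    nlinarith
  have hp0 : 0 < p := by
    by_contra h
    nlinarith
  have hpy : p * y * k = n - 2*k := by rw [← hp, ← hy]; ring
  have hnσ : 0 < (n:ℝ)+σ := by linarith
  have hch : (0:ℝ) < n.choose k := by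
    exact_mod_cast Nat.choose_pos (by omega)
  have hcnk : 0 < cnk n k := by rw [cnk]; positivity
  set K := lam / cnk n k with hK
  have hK0 : 0 < K := by positivity
  -- q + 1
  have hq1 : (q+1) * ((n:ℝ)-2*k) = (n+σ)*(k+1) := by linear_combination hq
  have hqpos : 0 < q + 1 := by
    by_contra h
    nlinarith [mul_pos hnσ (by linarith : (0:ℝ) < k+1)]
  -- basic
  set U : ℝ → ℝ := derivWithin u (Icc 0 1) with hU
  have hUc : ContinuousOn U (Icc 0 1) :=
    hC1.continuousOn_derivWithin (uniqueDiffOn_Icc zero_lt_one) le_rfl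
  have huc : ContinuousOn u (Icc 0 1) := hC1.continuousOn
  have hUe : ∀ r ∈ Ioo (0:ℝ) 1, U r = deriv u r := fun r hr =>
    derivWithin_of_mem_nhds (Icc_mem_nhds hr.1 hr.2)
  have hUev : ∀ r ∈ Ioo (0:ℝ) 1, U =ᶠ[nhds r] deriv u := fun r hr => by
    filter_upwards [Ioo_mem_nhds hr.1 hr.2] with s hs using hUe s hs
  have hud : ∀ r ∈ Ioo (0:ℝ) 1, HasDerivAt u (U r) r := fun r hr => by
    rw [hUe r hr]
    exact ((hC2.contDiffAt (Ioo_mem_nhds hr.1 hr.2)).differentiableAt (by norm_num)).hasDerivAt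
  have hUd : ∀ r ∈ Ioo (0:ℝ) 1, ∃ V, HasDerivAt U V r := fun r hr => by
    have h1 : ContDiffOn ℝ 1 (deriv u) (Ioo 0 1) :=
      hC2.deriv_of_isOpen isOpen_Ioo (by norm_num)
    have h2 := ((h1.contDiffAt (Ioo_mem_nhds hr.1 hr.2)).differentiableAt (by norm_num)).hasDerivAt
    exact ⟨_, h2.congr_of_eventuallyEq (hUev r hr)⟩
  have hule : ∀ r ∈ Icc (0:ℝ) 1, u r ≤ 0 := by
    have h1 : IsClosed (Icc (0:ℝ) 1 ∩ u ⁻¹' Iic 0) := huc.preimage_isClosed_of_isClosed isClosed_Icc isClosed_Iic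
    have h2 : closure (Ioo (0:ℝ) 1) ⊆ (Icc (0:ℝ) 1 ∩ u ⁻¹' Iic 0) :=
      closure_minimal (fun r hr => ⟨Ioo_subset_Icc_self hr, (huneg r hr).le⟩) h1
    rw [closure_Ioo zero_ne_one] at h2
    exact fun r hr => (h2 hr).2
  have hv0 : ∀ r ∈ Icc (0:ℝ) 1, 0 < 1 - u r := fun r hr => by linarith [hule r hr]
  have hrc : ∀ e : ℝ, 0 ≤ e → Continuous (fun r : ℝ => r^e) := fun e he =>
    Real.continuous_rpow_const he
  -- P
  set P : ℝ → ℝ := fun r => r^((n:ℝ)-k) * U r^k with hP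
  have hPc : ContinuousOn P (Icc 0 1) :=
    (hrc _ (by linarith)).continuousOn.mul (hUc.pow k)
  have hP0 : P 0 = 0 := by
    simp only [hP]; rw [zero_rpow (by linarith), zero_mul]
  have hPd : ∀ r ∈ Ioo (0:ℝ) 1, HasDerivAt P (K * r^((n:ℝ)+σ-1) * (1-u r)^q) r := by
    intro r hr
    obtain ⟨V, hV⟩ := hUd r hr
    have h1 : DifferentiableAt ℝ P r := by
      have : DifferentiableAt ℝ (fun r : ℝ => r^((n:ℝ)-k)) r :=
        (Real.hasDerivAt_rpow_const (Or.inl hr.1.ne')).differentiableAt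
      exact this.mul (hV.differentiableAt.pow k)
    have h2 : deriv P r = deriv (fun s => s ^ ((n : ℝ) - k) * (deriv u s) ^ k) r := by
      apply Filter.EventuallyEq.deriv_eq
      filter_upwards [hUev r hr] with s hs
      simp only [hP, hs]
    have h3 := hode r hr
    rw [← h2] at h3
    refine h1.hasDerivAt.congr_deriv ?_
    have e1 : r^((n:ℝ)+σ-1) = r^((n:ℝ)-1) * r^σ := by
      rw [← rpow_add hr.1]; ring_nf
    have e2 : r^((n:ℝ)-1) * r^(1-(n:ℝ)) = 1 := by
      rw [← rpow_add hr.1]; simp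
    rw [e1, hK]
    field_simp
    calc _ = (r^((n:ℝ)-1) * r^(1-(n:ℝ))) * cnk n k * deriv P r := by rw [e2]; ring
      _ = r^((n:ℝ)-1) * (cnk n k * r^(1-(n:ℝ)) * deriv P r) := by ring
      _ = _ := by rw [h3]; ring
  have hPpos : ∀ r ∈ Ioo (0:ℝ) 1, 0 < P r := by
    have : StrictMonoOn P (Icc 0 1) := by
      apply strictMonoOn_of_deriv_pos (convex_Icc _ _) hPc
      intro x hx
      rw [interior_Icc] at hx
      rw [(hPd x hx).deriv]
      have h1 := hv0 x (Ioo_subset_Icc_self hx)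
      have h2 := hx.1
      positivity
    intro r hr
    rw [← hP0]
    exact this (left_mem_Icc.2 zero_le_one) (Ioo_subset_Icc_self hr) hr.1
  have hUnn : ∀ r ∈ Ioo (0:ℝ) 1, 0 ≤ U r := by
    have hQc : ContinuousOn (fun r => r^((n:ℝ)-(1:ℕ)) * U r^1) (Icc 0 1) :=
      (hrc _ (by push_cast; linarith)).continuousOn.mul (hUc.pow 1)
    have : MonotoneOn (fun r => r^((n:ℝ)-(1:ℕ)) * U r^1) (Icc 0 1) := by
      apply monotoneOn_of_deriv_nonneg (convex_Icc _ _) hQc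
      · intro x hx
        rw [interior_Icc] at hx
        obtain ⟨V, hV⟩ := hUd x hx
        have : DifferentiableAt ℝ (fun r : ℝ => r^((n:ℝ)-(1:ℕ))) x :=
          (Real.hasDerivAt_rpow_const (Or.inl hx.1.ne')).differentiableAt
        exact (this.mul (hV.differentiableAt.pow 1)).differentiableWithinAt
      · intro x hx
        rw [interior_Icc] at hx
        have h1 := hmon 1 le_rfl hk x hx
        convert h1 using 1
        apply Filter.EventuallyEq.deriv_eq
        filter_upwards [hUev x hx] with s hs
        simp only [hs]
    intro r hr
    have h1 := this (left_mem_Icc.2 zero_le_one) (Ioo_subset_Icc_self hr) hr.1.le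
    simp only [pow_one] at h1
    rw [zero_rpow (by push_cast; linarith), zero_mul] at h1
    exact nonneg_of_mul_nonneg_right h1 (rpow_pos_of_pos hr.1 _)
  have hUpos : ∀ r ∈ Ioo (0:ℝ) 1, 0 < U r := by
    intro r hr
    refine lt_of_le_of_ne (hUnn r hr) fun h => ?_
    have h1 := hPpos r hr
    simp only [hP] at h1
    rw [← h, zero_pow (by omega), mul_zero] at h1
    exact lt_irrefl _ h1
  -- relation for V
  have hPV : ∀ r ∈ Ioo (0:ℝ) 1, ∀ V, HasDerivAt U V r →
      r * (K * r^((n:ℝ)+σ-1) * (1-u r)^q) * U r = (n-k) * P r * U r + k * r * P r * V := by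
    intro r hr V hV
    have h1 : HasDerivAt P _ r :=
      (Real.hasDerivAt_rpow_const (p := (n:ℝ)-k) (Or.inl hr.1.ne')).mul (hV.pow k)
    rw [(hPd r hr).unique h1]
    have e1 : r^((n:ℝ)-k) = r^((n:ℝ)-k-1) * r := by
      rw [← rpow_add_one hr.1.ne']; ring_nf
    have e2 : U r^k = U r^(k-1) * U r := by
      rw [← pow_succ]; congr 1; omega
    simp only [hP, e1, e2]
    ring
  -- conserved quantity
  set E : ℝ → ℝ := fun r => k * (r * (P r * U r)) + K * (n-2*k)/(n+σ) * (r^((n:ℝ)+σ) * (1-u r)^(q+1))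
    - (n-2*k) * (P r * (1 - u r)) with hE
  have hEc : ContinuousOn E (Icc 0 1) := by
    have h1 : ContinuousOn (fun r => 1 - u r) (Icc 0 1) := continuousOn_const.sub huc
    have h2 : ContinuousOn (fun r => (1 - u r)^(q+1)) (Icc 0 1) :=
      h1.rpow_const fun x hx => Or.inl (hv0 x hx).ne'
    have h3 := (hrc ((n:ℝ)+σ) hnσ.le).continuousOn (s := Icc 0 1)
    exact ((continuousOn_const.mul (continuousOn_id.mul (hPc.mul hUc))).add
      (continuousOn_const.mul (h3.mul h2))).sub (continuousOn_const.mul (hPc.mul h1))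
  have hE0 : E 0 = 0 := by
    simp only [hE, hP0]; rw [zero_rpow hnσ.ne']; ring
  have hEd : ∀ r ∈ Ioo (0:ℝ) 1, HasDerivAt E 0 r := by
    intro r hr
    obtain ⟨V, hV⟩ := hUd r hr
    have hvr := hv0 r (Ioo_subset_Icc_self hr)
    have d1 : HasDerivAt (fun r => 1 - u r) (-U r) r := (hud r hr).const_sub 1
    have d2 := d1.rpow_const (p := q+1) (Or.inl hvr.ne')
    have d3 := Real.hasDerivAt_rpow_const (p := (n:ℝ)+σ) (Or.inl hr.1.ne')
    have d4 := ((((hasDerivAt_id r).mul ((hPd r hr).mul hV)).const_mul (k:ℝ)).add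
      ((d3.mul d2).const_mul (K * (n-2*k)/(n+σ)))).sub (((hPd r hr).mul d1).const_mul ((n:ℝ)-2*k))
    refine HasDerivAt.congr_deriv d4 ?_
    have h1 := hPV r hr V hV
    have e1 : r^((n:ℝ)+σ) = r^((n:ℝ)+σ-1) * r := by
      rw [← rpow_add_one hr.1.ne']; ring_nf
    have e2 : (1-u r)^(q+1) = (1-u r)^q * (1-u r) := rpow_add_one hvr.ne' q
    have e3 : q + 1 - 1 = q := by ring
    have m1 : K * (n-2*k)/(n+σ) * (q+1) = K*(k+1) := by
      rw [div_mul_eq_mul_div, div_eq_iff hnσ.ne']; linear_combination K * hq1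
    have m2 : K * (n-2*k)/(n+σ) * (n+σ) = K*(n-2*k) := by
      rw [div_mul_cancel₀ _ hnσ.ne']
    simp only [Pi.mul_apply, id, e3, e1, e2]
    clear d4
    generalize (1-u r)^q = W at *
    generalize r^((n:ℝ)+σ-1) = R at *
    generalize P r = Pr at *
    linear_combination (-1:ℝ) * h1 - m1 * (R * r * U r * W) + m2 * (R * W * (1 - u r))
  have hEz : ∀ r ∈ Icc (0:ℝ) 1, E r = 0 := by
    intro r hr
    rw [← const_aux E 0 r hr.1 (hEc.mono (Icc_subset_Icc_right hr.2))
      (fun x hx => hEd x ⟨hx.1, hx.2.trans_le hr.2⟩), hE0]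
  -- second constant
  have hp1 : 1 + 1/p = (n+σ)/(n-2*k) := by
    rw [← hp]; field_simp; linarith
  set h : ℝ → ℝ := fun r => U r * ((1-u r)^(-(1+1/p)) * r^(1-y)) with hh
  have hhd : ∀ r ∈ Ioo (0:ℝ) 1, HasDerivAt h 0 r := by
    intro r hr
    obtain ⟨V, hV⟩ := hUd r hr
    have hvr := hv0 r (Ioo_subset_Icc_self hr)
    have d1 : HasDerivAt (fun r => 1 - u r) (-U r) r := (hud r hr).const_sub 1
    have d2 := d1.rpow_const (p := -(1+1/p)) (Or.inl hvr.ne')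
    have d3 := Real.hasDerivAt_rpow_const (p := 1-y) (Or.inl hr.1.ne')
    refine HasDerivAt.congr_deriv (hV.mul (d2.mul d3)) ?_
    have h1 := hPV r hr V hV
    have h2 := hEz r (Ioo_subset_Icc_self hr)
    have e1 : r^((n:ℝ)+σ) = r^((n:ℝ)+σ-1) * r := by
      rw [← rpow_add_one hr.1.ne']; ring_nf
    have e2 : (1-u r)^(q+1) = (1-u r)^q * (1-u r) := rpow_add_one hvr.ne' q
    have e3 : r^(1-y) = r^(1-y-1) * r := by
      rw [← rpow_add_one hr.1.ne']; ring_nf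
    have e4 : (1-u r)^(-(1+1/p)) = (1-u r)^(-(1+1/p)-1) * (1-u r) := by
      rw [← rpow_add_one hvr.ne']; ring_nf
    simp only [hE, e1, e2] at h2
    rw [e3, e4]
    have hPr := hPpos r hr
    have hUr := hUpos r hr
    have hr0 := hr.1
    have key : V * (1-u r) * r + (1+1/p) * U r * U r * r + (1-y) * U r * (1-u r) = 0 := by
      have ht : (1 + 1/p) * (n-2*k) = n+σ := by rw [hp1, div_mul_cancel₀ _ hn0.ne']
      have m2 : K * (n-2*k)/(n+σ) * (n+σ) = K*(n-2*k) := by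
        rw [div_mul_cancel₀ _ hnσ.ne']
      generalize (1-u r)^q = W at *
      generalize r^((n:ℝ)+σ-1) = R at *
      generalize P r = Pr at *
      generalize 1 - u r = v at *
      have hne : k * Pr * (n - 2*k) ≠ 0 := by positivity
      apply mul_left_cancel₀ hne
      linear_combination (-((n:ℝ) - 2*k) * v) * h1 + U r * (n+σ) * h2 - m2 * (U r * R * r * W * v)
        + ht * (k * U r^2 * r * Pr) - hy * ((n-2*k) * Pr * U r * v)
    linear_combination (1-u r)^(-(1+1/p)-1) * r^(1-y-1) * key
  obtain ⟨h0, hh0⟩ : ∃ h0, ∀ r ∈ Ioo (0:ℝ) 1, h r = h0 := by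
    have hx : ∀ r ∈ Ioo (0:ℝ) 1, ∀ s ∈ Ioo (0:ℝ) 1, r ≤ s → h r = h s := by
      intro r hr s hs hrs
      have hsub : Icc r s ⊆ Ioo 0 1 := fun x hx => ⟨hr.1.trans_le hx.1, hx.2.trans_lt hs.2⟩
      exact const_aux h r s hrs
        (fun x hx => (hhd x (hsub hx)).continuousAt.continuousWithinAt)
        (fun x hx => hhd x (hsub (Ioo_subset_Icc_self hx)))
    refine ⟨h (1/2), fun r hr => ?_⟩
    have hm : (1/2:ℝ) ∈ Ioo (0:ℝ) 1 := by norm_num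
    rcases le_total r (1/2) with hl | hl
    · exact hx r hr _ hm hl
    · exact (hx _ hm r hr hl).symm
  have hm : (1/2:ℝ) ∈ Ioo (0:ℝ) 1 := by norm_num
  have hh0pos : 0 < h0 := by
    rw [← hh0 _ hm]
    have h1 := hUpos _ hm
    have h2 := hv0 _ (Ioo_subset_Icc_self hm)
    simp only [hh]
    positivity
  have hy0 : 0 < y := by linarith
  have hUform : ∀ r ∈ Ioo (0:ℝ) 1, U r = h0 * ((1-u r)^(1+1/p) * r^(y-1)) := by
    intro r hr
    have hvr := hv0 r (Ioo_subset_Icc_self hr)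
    rw [← hh0 r hr]
    have e1 : (1-u r)^(-(1+1/p)) * (1-u r)^(1+1/p) = 1 := by
      rw [← rpow_add hvr]; simp
    have e2 : r^(1-y) * r^(y-1) = 1 := by
      rw [← rpow_add hr.1]; simp
    simp only [hh]
    linear_combination (-U r) * e1 * (r^(1-y) * r^(y-1)) - U r * e2
  set b := h0 / (p*y) with hb
  have hb0 : 0 < b := by positivity
  set G : ℝ → ℝ := fun r => (1-u r)^(-(1/p)) - b * r^y with hG
  have hGc : ContinuousOn G (Icc 0 1) := by
    have h1 : ContinuousOn (fun r => 1 - u r) (Icc 0 1) := continuousOn_const.sub huc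
    exact (h1.rpow_const fun x hx => Or.inl (hv0 x hx).ne').sub
      (continuousOn_const.mul (hrc y hy0.le).continuousOn)
  have hGd : ∀ r ∈ Ioo (0:ℝ) 1, HasDerivAt G 0 r := by
    intro r hr
    have hvr := hv0 r (Ioo_subset_Icc_self hr)
    have d1 : HasDerivAt (fun r => 1 - u r) (-U r) r := (hud r hr).const_sub 1
    have d2 := d1.rpow_const (p := -(1/p)) (Or.inl hvr.ne')
    have d3 := Real.hasDerivAt_rpow_const (p := y) (Or.inl hr.1.ne')
    refine HasDerivAt.congr_deriv (d2.sub (d3.const_mul b)) ?_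
    rw [hUform r hr]
    have e1 : (1-u r)^(1+1/p) * (1-u r)^(-(1/p)-1) = 1 := by
      rw [← rpow_add hvr]; ring_nf; simp
    have e2 : b * y = h0 / p := by rw [hb]; field_simp
    linear_combination (h0/p) * r^(y-1) * e1 - e2 * r^(y-1)
  have hGz : ∀ r ∈ Icc (0:ℝ) 1, G r = G 0 := fun r hr =>
    (const_aux G 0 r hr.1 (hGc.mono (Icc_subset_Icc_right hr.2))
      (fun x hx => hGd x ⟨hx.1, hx.2.trans_le hr.2⟩)).symm
  set g := G 0 with hg
  have hg0 : 0 < g := by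
    have h1 := hv0 0 (left_mem_Icc.2 zero_le_one)
    simp only [hg, hG]
    rw [zero_rpow hy0.ne', mul_zero, sub_zero]
    positivity
  have hgr : ∀ r ∈ Icc (0:ℝ) 1, (1-u r)^(-(1/p)) = g + b*r^y := by
    intro r hr
    have := hGz r hr
    simp only [hG] at this
    linarith
  refine ⟨g, b, hg0, hb0, ?_, ?_, ?_⟩
  · have := hgr 1 (right_mem_Icc.2 zero_le_one)
    rw [hu1] at this
    simpa using this.symm
  · generalize (1/2:ℝ) = r at hm
    have hvr := hv0 r (Ioo_subset_Icc_self hm)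
    have h2 := hEz r (Ioo_subset_Icc_self hm)
    have h3 := hgr r (Ioo_subset_Icc_self hm)
    have hUr := hUform r hm
    have hr0 := hm.1
    have hbh : h0 = b * ((n-2*k)/k) := by
      rw [hb, ← hpy]; field_simp
    have e1 : P r = h0^k * (1-u r)^(k*(1+1/p)) * r^((n:ℝ)+σ) := by
      simp only [hP]
      rw [hUr, mul_pow, mul_pow, ← rpow_natCast ((1-u r)^(1+1/p)), ← rpow_mul hvr.le,
        ← rpow_natCast (r^(y-1)), ← rpow_mul hr0.le]
      have : r^((n:ℝ)+σ) = r^((n:ℝ)-k) * r^((y-1)*k) := by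
        rw [← rpow_add hr0]; congr 1; linarith
      rw [this, mul_comm (1+1/p)]; ring
    have e2 : (1-u r)^(q+1) = (1-u r)^(k*(1+1/p)) * (1-u r)^(1+1/p) := by
      rw [← rpow_add hvr]; congr 1
      have : q + 1 = (n+σ)*(k+1)/(n-2*k) := by rw [eq_div_iff hn0.ne']; exact hq1
      rw [this, hp1]; ring
    have e3 : r * r^(y-1) = r^y := by
      rw [mul_comm, ← rpow_add_one hr0.ne']; ring_nf
    have e4 : (1-u r)^(1+1/p) * (g + b*r^y) = 1 - u r := by
      rw [← h3, ← rpow_add hvr]; simp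
    simp only [hE] at h2
    rw [hUr, e2] at h2
    have hX : 0 < (1-u r)^(1+1/p) := by positivity
    have hY : 0 < (1-u r)^(k*(1+1/p)) := by positivity
    have hR : 0 < r^((n:ℝ)+σ) := by positivity
    have h5 : K/(n+σ) = g * h0^k := by
      have hne : (1-u r)^(1+1/p) * (1-u r)^(k*(1+1/p)) * r^((n:ℝ)+σ) * (n-2*k) ≠ 0 := by positivity
      apply mul_left_cancel₀ hne
      have hkh : k * h0 = b * (n-2*k) := by rw [hbh]; field_simp
      have h6 : k * (r * (P r * (h0 * ((1-u r)^(1+1/p) * r^(y-1))))) =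
        b * (n-2*k) * P r * (1-u r)^(1+1/p) * r^y := by
        rw [← hkh, ← e3]; ring
      rw [h6, ← e4, e1] at h2
      rw [e4] at h2
      generalize (1-u r)^(1+1/p) = X at *
      generalize (1-u r)^(k*(1+1/p)) = Y at *
      generalize r^((n:ℝ)+σ) = R at *
      generalize r^y = Ry at *
      rw [← e4] at h2
      linear_combination h2
    rw [hbh, mul_pow, hK, cnk] at h5
    field_simp at h5
    field_simp
    linear_combination h5
  · intro r hr
    have hvr := hv0 r hr
    rw [← hgr r hr, ← rpow_mul hvr.le]
    have : -(1/p) * -p = 1 := by field_simp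
    rw [this, rpow_one]; ring

lemma wFun_form (n k : ℕ) (hk : 1 ≤ k) (hn : 2 * k < n) (σ : ℝ) (hσ : 0 ≤ σ) (lam : ℝ)
    (hlam : 0 < lam) (d : ℝ) (hd : 0 < d)
    (hroot : lam * (d + 1) ^ (k + 1) =
        (n.choose k : ℝ) * (((n : ℝ) - 2 * k) / k) ^ k * (((n : ℝ) + σ) / n) * d ^ k) :
    (fun r => 1 + wFun n k σ lam (1 / d) r) = fun r =>
      1 + -((d/(d+1))^(-(((n : ℝ) - 2 * k) / (2 * (k : ℝ) + σ))) *
        (1/d + r ^ ((2 * (k : ℝ) + σ) / k)) ^ (-(((n : ℝ) - 2 * k) / (2 * (k : ℝ) + σ)))) := by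
  have hk0 : (0:ℝ) < k := by exact_mod_cast hk
  have h2kσ : 0 < 2*(k:ℝ)+σ := by positivity
  have h1 : 1/d * (n.choose k : ℝ) * (((n : ℝ) + σ) / n) * (((n : ℝ) - 2 * k) / k) ^ k =
      lam * ((d/(d+1))^(k+1))⁻¹ := by
    rw [div_pow d (d+1), inv_div]
    have : lam * ((d+1)^(k+1)/d^(k+1)) = lam * (d+1)^(k+1) / d^(k+1) := by ring
    rw [this, hroot, eq_div_iff (by positivity), pow_succ]
    have : 1/d * d = 1 := by field_simp
    linear_combination ((n.choose k : ℝ) * (((n : ℝ) - 2 * k) / k) ^ k * (((n : ℝ) + σ) / n) * d ^ k) * this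
  have hb : 0 < d/(d+1) := by positivity
  funext r
  simp only [wFun]
  rw [h1, mul_rpow hlam.le (by positivity), ← mul_assoc, ← rpow_add hlam, neg_add_cancel,
    rpow_zero, one_mul, ← rpow_natCast, ← rpow_neg hb.le, ← rpow_mul hb.le]
  congr 4
  push_cast
  field_simp

/-- for `q = q*(k,σ)` and `0 < λ < μ*(k,σ)` problem `(P_λ)` has exactly two
classical radial solutions, `1 + w_{1/d_-}` and `1 + w_{1/d_+}`, where `d_- < d_+` are the
two positive roots of `λ(d+1)^{k+1} = binom(n,k) ((n-2k)/k)^k ((n+σ)/n) d^k`. -/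
theorem exactly_two_solutions_critical (n k : ℕ) (hk : 1 ≤ k) (hn : 2 * k < n)
    (σ : ℝ) (hσ : 0 ≤ σ) (lam : ℝ) (hlam0 : 0 < lam) (hlam : lam < muStar n k σ) :
    ∃ dm dp : ℝ, 0 < dm ∧ dm < dp ∧
      lam * (dm + 1) ^ (k + 1) =
        (n.choose k : ℝ) * (((n : ℝ) - 2 * k) / k) ^ k * (((n : ℝ) + σ) / n) * dm ^ k ∧
      lam * (dp + 1) ^ (k + 1) =
        (n.choose k : ℝ) * (((n : ℝ) - 2 * k) / k) ^ k * (((n : ℝ) + σ) / n) * dp ^ k ∧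
      (∀ d : ℝ, 0 < d →
        lam * (d + 1) ^ (k + 1) =
          (n.choose k : ℝ) * (((n : ℝ) - 2 * k) / k) ^ k * (((n : ℝ) + σ) / n) * d ^ k →
        d = dm ∨ d = dp) ∧
      IsRadialSol n k (qstar n k σ) σ lam (fun r => 1 + wFun n k σ lam (1 / dm) r) ∧
      IsRadialSol n k (qstar n k σ) σ lam (fun r => 1 + wFun n k σ lam (1 / dp) r) ∧
      ∀ u : ℝ → ℝ, IsRadialSol n k (qstar n k σ) σ lam u →
        EqOn u (fun r => 1 + wFun n k σ lam (1 / dm) r) (Icc 0 1) ∨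
        EqOn u (fun r => 1 + wFun n k σ lam (1 / dp) r) (Icc 0 1) := by

  have hk0 : (0:ℝ) < k := by exact_mod_cast hk
  have h2kσ : 0 < 2*(k:ℝ)+σ := by positivity
  have hn0 : (0:ℝ) < (n:ℝ) - 2*k := by
    have : ((2*k:ℕ):ℝ) < n := by exact_mod_cast hn
    push_cast at this; linarith
  have hy : (k:ℝ) * ((2 * (k : ℝ) + σ) / k) = 2*k+σ := by field_simp
  have hp : ((n : ℝ) - 2 * k) / (2 * (k : ℝ) + σ) * (2 * (k : ℝ) + σ) = n - 2*k :=
    div_mul_cancel₀ _ h2kσ.ne'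
  have hq : qstar n k σ * ((n:ℝ)-2*k) = (n+2)*k+σ*(k+1) := by
    rw [qstar, div_mul_cancel₀ _ hn0.ne']
  have hpq : ((n : ℝ) - 2 * k) / (2 * (k : ℝ) + σ) * (qstar n k σ - k) = k + 1 := by
    rw [div_mul_eq_mul_div, div_eq_iff h2kσ.ne']
    linear_combination hq
  obtain ⟨dm, dp, h1, h2, h3, h4, h5⟩ := roots_aux k hk lam
    ((n.choose k : ℝ) * (((n : ℝ) - 2 * k) / k) ^ k * (((n : ℝ) + σ) / n)) hlam0 (by
      rw [muStar, lt_div_iff₀ (by positivity)] at hlam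
      refine hlam.trans_eq ?_
      rw [div_pow]
      field_simp)
  have hsol : ∀ d : ℝ, 0 < d → lam * (d + 1) ^ (k + 1) =
        (n.choose k : ℝ) * (((n : ℝ) - 2 * k) / k) ^ k * (((n : ℝ) + σ) / n) * d ^ k →
      IsRadialSol n k (qstar n k σ) σ lam (fun r => 1 + wFun n k σ lam (1 / d) r) := by
    intro d hd hroot
    rw [wFun_form n k hk hn σ hσ lam hlam0 d hd hroot]
    have hb : 0 < d/(d+1) := by positivity
    refine isSol n k hk hn σ hσ lam _ _ _ _ _ hy hp hq (by positivity) (by positivity) ?_ ?_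
    · rw [← mul_rpow (by positivity) (by positivity)]
      have : d/(d+1) * (1/d+1) = 1 := by field_simp; ring
      rw [this, one_rpow]
    · rw [← rpow_mul hb.le, neg_mul, hpq, rpow_neg hb.le]
      have : (d/(d+1))^((k:ℝ)+1) = (d/(d+1))^(k+1) := by
        rw [← rpow_natCast]; push_cast; rfl
      rw [this, div_pow d (d+1), inv_div, ← mul_div_assoc lam, hroot, eq_div_iff (by positivity), pow_succ]
      have : 1/d * d = 1 := by field_simp
      linear_combination ((n.choose k : ℝ) * (((n : ℝ) - 2 * k) / k) ^ k * (((n : ℝ) + σ) / n) * d ^ k) * this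
  have hdp : 0 < dp := h1.trans h2
  refine ⟨dm, dp, h1, h2, h3, h4, h5, hsol dm h1 h3, hsol dp hdp h4, ?_⟩
  intro u hu
  obtain ⟨g, b, hg, hb, hgb, hl, hur⟩ := unique_aux n k hk hn σ hσ lam hlam0 _ _ _ hy hp hq u hu
  have hd : 0 < b/g := by positivity
  have hd1 : b/g + 1 = 1/g := by field_simp; linarith
  have hroot : lam * (b/g + 1) ^ (k + 1) =
        (n.choose k : ℝ) * (((n : ℝ) - 2 * k) / k) ^ k * (((n : ℝ) + σ) / n) * (b/g) ^ k := by
    rw [hd1]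
    generalize (n.choose k : ℝ) * (((n : ℝ) - 2 * k) / k) ^ k * (((n : ℝ) + σ) / n) = B at hl
    rw [hl, div_pow, div_pow, one_pow, pow_succ]
    field_simp
  have heq : EqOn u (fun r => 1 + wFun n k σ lam (1 / (b/g)) r) (Icc 0 1) := by
    rw [wFun_form n k hk hn σ hσ lam hlam0 _ hd hroot]
    intro r hr
    have hry : 0 ≤ r ^ ((2 * (k : ℝ) + σ) / k) := rpow_nonneg hr.1 _
    have e1 : b/g/(b/g+1) = b := by rw [hd1]; field_simp
    simp only
    rw [hur r hr, e1, ← mul_rpow hb.le (by positivity)]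
    have e2 : b * (1/(b/g) + r ^ ((2 * (k : ℝ) + σ) / k)) = g + b * r ^ ((2 * (k : ℝ) + σ) / k) := by
      field_simp
    rw [e2]; ring
  rcases h5 _ hd hroot with h | h
  · left; rw [h] at heq; exact heq
  · right; rw [h] at heq; exact heq
end
end
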